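/- For every convex body K ⊆ ℝ² of unit area, let S be a set of n points drawn uniformly and independently at random from K, and let N₁(n) be the number of 4-holes H in S such that the pair of points of H at the largest distance among all pairs of points of H forms a diagonal of the convex quadrilateral conv(H) (i.e., the two points are not consecutive vertices of conv(H)). Then n^{-2} · E[N₁(n)] converges to 2 as n → ∞. -/

import Mathlib

open MeasureTheory Filter

noncomputable section

abbrev Euc (d : ℕ) : Type := EuclideanSpace ℝ (Fin d)

/-- A convex body: compact convex set with nonempty interior. -/
def IsConvexBody {d : ℕ} (K : Set (Euc d)) : Prop :=
  Convex ℝ K ∧ IsCompact K ∧ (interior K).Nonempty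

/-- A set of points is in convex position if no point lies in the convex
hull of the others. -/
def InConvexPosition {d : ℕ} (P : Set (Euc d)) : Prop :=
  ∀ p ∈ P, p ∉ convexHull ℝ (P \ {p})

/-- `H` is a `k`-hole in `S`. -/
def IsHole {d : ℕ} (k : ℕ) (S H : Finset (Euc d)) : Prop :=
  H ⊆ S ∧ H.card = k ∧ InConvexPosition (H : Set (Euc d)) ∧
    ∀ p ∈ S, p ∉ interior (convexHull ℝ (H : Set (Euc d)))

open Classical in
/-- The number of `k`-holes in the point set given by `x`. -/
noncomputable def holeCount (d k n : ℕ) (x : Fin n → Euc d) : ℕ :=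
  ((Finset.image x Finset.univ).powerset.filter
    (fun H => IsHole k (Finset.image x Finset.univ) H)).card

/-- The uniform probability distribution on `K`. -/
noncomputable def unif {d : ℕ} (K : Set (Euc d)) : Measure (Euc d) :=
  (volume K)⁻¹ • volume.restrict K

/-- The expected number of `k`-holes among `n` points drawn uniformly and
independently at random from `K`. -/
noncomputable def EH (d k : ℕ) (K : Set (Euc d)) (n : ℕ) : ℝ :=
  ∫ x : Fin n → Euc d, (holeCount d k n x : ℝ) ∂(Measure.pi fun _ : Fin n => unif K)

/-- The probability that, for `d+2` points chosen uniformly and independently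
at random from `K`, one of the points lies in the convex hull of the others. -/
noncomputable def pSimplex (d : ℕ) (K : Set (Euc d)) : ℝ :=
  ((Measure.pi fun _ : Fin (d + 2) => unif K)
    {x : Fin (d + 2) → Euc d | ∃ i, x i ∈ convexHull ℝ (x '' {j | j ≠ i})}).toReal

/-- The maximum of `pSimplex d K` over all convex bodies `K ⊆ ℝ^d`. -/
noncomputable def pMax (d : ℕ) : ℝ :=
  sSup {p : ℝ | ∃ K : Set (Euc d), IsConvexBody K ∧ p = pSimplex d K}

end

open Classical in
/-- `H` is a 4-point set whose maximum-distance pair `{a, b}` forms a diagonal of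
the convex quadrilateral `conv H`, i.e. the open diagonal segments cross. -/
def MaxPairIsDiagonal (H : Finset (Euc 2)) : Prop :=
  ∃ a b c d : Euc 2, H = {a, b, c, d} ∧ H.card = 4 ∧
    (∀ p ∈ H, ∀ q ∈ H, dist p q ≤ dist a b) ∧
    (openSegment ℝ a b ∩ openSegment ℝ c d).Nonempty

open Classical in
/-- The number of 4-holes of the point set given by `x` whose maximum-distance
pair forms a diagonal of the hole. -/
noncomputable def holeCountDiag (n : ℕ) (x : Fin n → Euc 2) : ℕ :=
  ((Finset.image x Finset.univ).powerset.filter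
    (fun H => IsHole 4 (Finset.image x Finset.univ) H ∧ MaxPairIsDiagonal H)).card

/-- The expected number of 4-holes of the first (diagonal) type among `n` points
drawn uniformly and independently at random from `K`. -/
noncomputable def EHdiag (K : Set (Euc 2)) (n : ℕ) : ℝ :=
  ∫ x : Fin n → Euc 2, (holeCountDiag n x : ℝ) ∂(Measure.pi fun _ : Fin n => unif K)

/-- Twice the signed area of the triangle `a b p`. -/
def cross (a b p : Euc 2) : ℝ :=
  (b 0 - a 0) * (p 1 - a 1) - (b 1 - a 1) * (p 0 - a 0)

/-- The point with coordinates `(x, y)` in the orthogonal frame with origin `a` and first basis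
vector `b - a`. -/
noncomputable def frame (a b : Euc 2) (x y : ℝ) : Euc 2 :=
  !₂[a 0 + x * (b 0 - a 0) - y * (b 1 - a 1), a 1 + x * (b 1 - a 1) + y * (b 0 - a 0)]

/-- The segment `ab` is the longest among the segments spanned by `a, b, c, d`, with `c` strictly
to its left and `d` strictly to its right. -/
structure IsLongDiagonal (a b c d : Euc 2) : Prop where
  left : 0 < cross a b c
  right : cross a b d < 0
  dist_ac : dist a c ≤ dist a b
  dist_bc : dist b c ≤ dist a b
  dist_ad : dist a d ≤ dist a b
  dist_bd : dist b d ≤ dist a b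
  dist_cd : dist c d ≤ dist a b

/-- The open convex quadrilateral with counterclockwise vertices `a, d, b, c`. -/
def openQuad (a b c d : Euc 2) : Set (Euc 2) :=
  {p | 0 < cross a d p ∧ 0 < cross d b p ∧ 0 < cross b c p ∧ 0 < cross c a p}

@[simp] lemma frame_apply_zero (a b : Euc 2) (x y : ℝ) :
    frame a b x y 0 = a 0 + x * (b 0 - a 0) - y * (b 1 - a 1) := rfl

@[simp] lemma frame_apply_one (a b : Euc 2) (x y : ℝ) :
    frame a b x y 1 = a 1 + x * (b 1 - a 1) + y * (b 0 - a 0) := rfl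

lemma frame_zero_zero (a b : Euc 2) : frame a b 0 0 = a := by
  ext i; fin_cases i <;> simp

lemma frame_one_zero (a b : Euc 2) : frame a b 1 0 = b := by
  ext i; fin_cases i <;> simp

lemma dist_sq_eq (p q : Euc 2) : dist p q ^ 2 = (p 0 - q 0) ^ 2 + (p 1 - q 1) ^ 2 := by
  rw [EuclideanSpace.dist_eq, Real.sq_sqrt (by positivity), Fin.sum_univ_two]
  simp [Real.dist_eq]

lemma dist_sq_pos {a b : Euc 2} (h : a ≠ b) : 0 < dist a b ^ 2 := by
  have := dist_pos.2 h
  positivity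

lemma dist_sq_frame (a b : Euc 2) (x y x' y' : ℝ) :
    dist (frame a b x y) (frame a b x' y') ^ 2
      = dist a b ^ 2 * ((x - x') ^ 2 + (y - y') ^ 2) := by
  simp only [dist_sq_eq, frame_apply_zero, frame_apply_one]; ring

lemma cross_frame (a b : Euc 2) (x y x' y' x'' y'' : ℝ) :
    cross (frame a b x y) (frame a b x' y') (frame a b x'' y'')
      = dist a b ^ 2 * ((x' - x) * (y'' - y) - (y' - y) * (x'' - x)) := by
  simp only [dist_sq_eq, cross, frame_apply_zero, frame_apply_one]; ring

lemma exists_eq_frame {a b : Euc 2} (h : a ≠ b) (p : Euc 2) : ∃ x y, p = frame a b x y := by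
  have hL := dist_sq_pos h
  rw [dist_sq_eq] at hL
  refine ⟨((p 0 - a 0) * (b 0 - a 0) + (p 1 - a 1) * (b 1 - a 1)) /
    ((a 0 - b 0) ^ 2 + (a 1 - b 1) ^ 2), cross a b p / ((a 0 - b 0) ^ 2 + (a 1 - b 1) ^ 2), ?_⟩
  ext i
  fin_cases i
  · simp only [Fin.zero_eta, frame_apply_zero, cross]
    field_simp
    ring
  · simp only [Fin.mk_one, frame_apply_one, cross]
    field_simp
    ring

lemma dist_frame_le_iff {a b : Euc 2} (h : a ≠ b) (x y x' y' : ℝ) :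
    dist (frame a b x y) (frame a b x' y') ≤ dist a b ↔ (x - x') ^ 2 + (y - y') ^ 2 ≤ 1 := by
  have hL := dist_sq_pos h
  rw [← sq_le_sq₀ dist_nonneg dist_nonneg, dist_sq_frame]
  exact mul_le_iff_le_one_right hL

lemma cross_frame_base (a b : Euc 2) (x y : ℝ) :
    cross a b (frame a b x y) = dist a b ^ 2 * y := by
  have := cross_frame a b 0 0 1 0 x y
  rw [frame_zero_zero, frame_one_zero] at this
  rw [this]; ring

/-- The long-diagonal condition in the frame coordinates. -/
lemma isLongDiagonal_frame_iff {a b : Euc 2} (h : a ≠ b) (x y x' y' : ℝ) :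
    IsLongDiagonal a b (frame a b x y) (frame a b x' y') ↔
      0 < y ∧ y' < 0 ∧ x ^ 2 + y ^ 2 ≤ 1 ∧ (1 - x) ^ 2 + y ^ 2 ≤ 1 ∧
        x' ^ 2 + y' ^ 2 ≤ 1 ∧ (1 - x') ^ 2 + y' ^ 2 ≤ 1 ∧ (x - x') ^ 2 + (y - y') ^ 2 ≤ 1 := by
  have hL := dist_sq_pos h
  have key : ∀ u v, (dist a (frame a b u v) ≤ dist a b ↔ u ^ 2 + v ^ 2 ≤ 1) ∧
      (dist b (frame a b u v) ≤ dist a b ↔ (1 - u) ^ 2 + v ^ 2 ≤ 1) := fun u v => by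
    have h0 := dist_frame_le_iff h 0 0 u v
    have h1 := dist_frame_le_iff h 1 0 u v
    rw [frame_zero_zero] at h0
    rw [frame_one_zero] at h1
    simpa using And.intro h0 h1
  have hc : 0 < cross a b (frame a b x y) ↔ 0 < y := by
    rw [cross_frame_base]; exact mul_pos_iff_of_pos_left hL
  have hd : cross a b (frame a b x' y') < 0 ↔ y' < 0 := by
    rw [cross_frame_base]; exact ⟨fun h' => by by_contra! h0; nlinarith [mul_nonneg hL.le h0],
      mul_neg_of_pos_of_neg hL⟩
  constructor
  · rintro ⟨h1, h2, h3, h4, h5, h6, h7⟩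
    exact ⟨hc.1 h1, hd.1 h2, (key _ _).1.1 h3, (key _ _).2.1 h4, (key _ _).1.1 h5,
      (key _ _).2.1 h6, (dist_frame_le_iff h _ _ _ _).1 h7⟩
  · rintro ⟨h1, h2, h3, h4, h5, h6, h7⟩
    exact ⟨hc.2 h1, hd.2 h2, (key _ _).1.2 h3, (key _ _).2.2 h4, (key _ _).1.2 h5,
      (key _ _).2.2 h6, (dist_frame_le_iff h _ _ _ _).2 h7⟩

lemma mem_Ioo_of_lens {x y : ℝ} (hy : y ≠ 0) (h0 : x ^ 2 + y ^ 2 ≤ 1)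
    (h1 : (1 - x) ^ 2 + y ^ 2 ≤ 1) : x ∈ Set.Ioo (0 : ℝ) 1 := by
  have : 0 < y ^ 2 := by positivity
  constructor <;> nlinarith

lemma IsLongDiagonal.ne {a b c d : Euc 2} (h : IsLongDiagonal a b c d) : a ≠ b := by
  rintro rfl
  simpa [cross] using h.left

lemma IsLongDiagonal.symm {a b c d : Euc 2} (h : IsLongDiagonal a b c d) :
    IsLongDiagonal b a d c := by
  have e : ∀ p, cross b a p = - cross a b p := fun p => by simp only [cross]; ring
  obtain ⟨h1, h2, h3, h4, h5, h6, h7⟩ := h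
  refine ⟨?_, ?_, ?_, ?_, ?_, ?_, ?_⟩ <;>
    first
    | (rw [e]; linarith)
    | (rw [dist_comm b a]; first | assumption | (rw [dist_comm]; assumption))

/-- Coordinates of a long-diagonal quadruple. -/
lemma IsLongDiagonal.exists_frame {a b c d : Euc 2} (h : IsLongDiagonal a b c d) :
    ∃ x y x' y', c = frame a b x y ∧ d = frame a b x' y' ∧ 0 < y ∧ y' < 0 ∧
      x ∈ Set.Ioo (0 : ℝ) 1 ∧ x' ∈ Set.Ioo (0 : ℝ) 1 := by
  obtain ⟨x, y, rfl⟩ := exists_eq_frame h.ne c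
  obtain ⟨x', y', rfl⟩ := exists_eq_frame h.ne d
  obtain ⟨h1, h2, h3, h4, h5, h6, -⟩ := (isLongDiagonal_frame_iff h.ne _ _ _ _).1 h
  exact ⟨x, y, x', y', rfl, rfl, h1, h2, mem_Ioo_of_lens h1.ne' h3 h4,
    mem_Ioo_of_lens h2.ne h5 h6⟩

/-- Membership in the open quadrilateral in the frame coordinates. -/
lemma frame_mem_openQuad_iff {a b : Euc 2} (h : a ≠ b) (x y x' y' u v : ℝ) :
    frame a b u v ∈ openQuad a b (frame a b x y) (frame a b x' y') ↔
      0 < x' * v - y' * u ∧ 0 < (1 - x') * v - y' * (1 - u) ∧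
        0 < y * (1 - u) - (1 - x) * v ∧ 0 < y * u - x * v := by
  have hL := dist_sq_pos h
  have h1 := cross_frame a b 0 0 x' y' u v
  have h2 := cross_frame a b x' y' 1 0 u v
  have h3 := cross_frame a b 1 0 x y u v
  have h4 := cross_frame a b x y 0 0 u v
  rw [frame_zero_zero] at h1 h4
  rw [frame_one_zero] at h2 h3
  simp only [openQuad, Set.mem_ofPred_eq, h1, h2, h3, h4, mul_pos_iff_of_pos_left hL]
  ring_nf

/-- A point with nonnegative barycentric coordinates belongs to the triangle. -/
lemma frame_mem_convexHull {a b c : Euc 2} {x y u v : ℝ} (hy : y ≠ 0) (hc : c = frame a b x y)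
    {s : Set (Euc 2)} (ha : a ∈ s) (hb : b ∈ s) (hcs : c ∈ s) (hv : 0 ≤ v / y)
    (hu : 0 ≤ u - x * (v / y)) (hu' : 0 ≤ 1 - u - (1 - x) * (v / y)) :
    frame a b u v ∈ convexHull ℝ s := by
  have hconv := convex_convexHull ℝ s
  have h := hconv.sum_mem (t := Finset.univ)
    (w := ![1 - u - (1 - x) * (v / y), u - x * (v / y), v / y]) (z := ![a, b, c])
    (by intro i _; fin_cases i <;> simp <;> linarith)
    (by simp [Fin.sum_univ_three]; ring)
    (by intro i _; fin_cases i <;> simp <;> apply subset_convexHull ℝ s <;> assumption)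
  convert h using 1
  subst hc
  ext i
  fin_cases i <;> simp [Fin.sum_univ_three] <;> field_simp <;> ring

lemma continuous_cross_right (a b : Euc 2) : Continuous (cross a b) := by
  unfold cross; fun_prop

lemma isOpen_openQuad (a b c d : Euc 2) : IsOpen (openQuad a b c d) := by
  have h := fun p q : Euc 2 => 
    isOpen_lt (continuous_const (y := (0 : ℝ))) (continuous_cross_right p q)
  exact (h _ _).inter ((h _ _).inter ((h _ _).inter (h _ _)))

lemma convex_cross_nonneg (a b : Euc 2) : Convex ℝ {p | 0 ≤ cross a b p} := by
  intro p hp q hq s t hs ht hst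
  simp only [Set.mem_ofPred_eq] at *
  have : cross a b (s • p + t • q) = s * cross a b p + t * cross a b q := by
    obtain rfl : t = 1 - s := by linarith
    simp only [cross, PiLp.add_apply, PiLp.smul_apply, smul_eq_mul]; ring
  rw [this]; positivity

lemma convexHull_subset_cross_nonneg {a b : Euc 2} {s : Set (Euc 2)}
    (h : ∀ p ∈ s, 0 ≤ cross a b p) : convexHull ℝ s ⊆ {p | 0 ≤ cross a b p} :=
  convexHull_min h (convex_cross_nonneg a b)

lemma cross_pos_of_mem_interior {a b : Euc 2} (hab : a ≠ b) {s : Set (Euc 2)}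
    (h : ∀ p ∈ s, 0 ≤ cross a b p) {p : Euc 2} (hp : p ∈ interior s) : 0 < cross a b p := by
  by_contra! hneg
  obtain ⟨u, v, rfl⟩ := exists_eq_frame hab p
  have hc : Continuous fun t : ℝ => frame a b u (v - t) := by
    unfold frame; fun_prop
  have hmem : ∀ᶠ t in nhdsWithin (0 : ℝ) (Set.Ioi 0), frame a b u (v - t) ∈ s := by
    apply nhdsWithin_le_nhds
    apply hc.continuousAt.eventually_mem
    simpa using mem_interior_iff_mem_nhds.1 hp
  obtain ⟨t, ht, ht0⟩ := (hmem.and self_mem_nhdsWithin).exists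
  have h1 := h _ ht
  have hL := dist_sq_pos hab
  rw [cross_frame_base] at h1 hneg
  have : (0 : ℝ) < t := ht0
  nlinarith [mul_pos hL this]

/-- All the cross products of a long-diagonal quadruple along the boundary are positive. -/
lemma IsLongDiagonal.cross_pos {a b c d : Euc 2} (h : IsLongDiagonal a b c d) :
    (0 < cross a d b ∧ 0 < cross a d c) ∧ (0 < cross d b a ∧ 0 < cross d b c) ∧
      (0 < cross b c a ∧ 0 < cross b c d) ∧ (0 < cross c a b ∧ 0 < cross c a d) ∧
      0 < cross d c a ∧ 0 < cross c d b := by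
  have hab := h.ne
  have hL := dist_sq_pos hab
  obtain ⟨x, y, x', y', rfl, rfl, hy, hy', ⟨hx0, hx1⟩, ⟨hx0', hx1'⟩⟩ := h.exists_frame
  have key := cross_frame a b
  have p1 := mul_pos hx0 hy
  have p2 := mul_pos hx0' hy
  have p3 := mul_pos hx0 (neg_pos.2 hy')
  have p4 := mul_pos (sub_pos.2 hx1) hy
  have p5 := mul_pos (sub_pos.2 hx1') hy
  have p6 := mul_pos (sub_pos.2 hx1) (neg_pos.2 hy')
  have k1 := key 0 0 x' y' 1 0
  have k2 := key 0 0 x' y' x y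
  have k3 := key x' y' 1 0 0 0
  have k4 := key x' y' 1 0 x y
  have k5 := key 1 0 x y 0 0
  have k6 := key 1 0 x y x' y'
  have k7 := key x y 0 0 1 0
  have k8 := key x y 0 0 x' y'
  have k9 := key x' y' x y 0 0
  have k10 := key x y x' y' 1 0
  simp only [frame_zero_zero, frame_one_zero] at k1 k2 k3 k4 k5 k6 k7 k8 k9 k10
  rw [k1, k2, k3, k4, k5, k6, k7, k8, k9, k10]
  refine ⟨⟨?_, ?_⟩, ⟨?_, ?_⟩, ⟨?_, ?_⟩, ⟨?_, ?_⟩, ?_, ?_⟩ <;> apply mul_pos hL <;> nlinarith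

lemma cross_self_left (a b : Euc 2) : cross a b a = 0 := by simp [cross]

lemma cross_self_right (a b : Euc 2) : cross a b b = 0 := by simp only [cross]; ring

lemma ne_of_cross_pos {a b p : Euc 2} (h : 0 < cross a b p) : a ≠ b := by
  rintro rfl; simp [cross] at h

/-- The open quadrilateral is the interior of the convex hull of its vertices. -/
lemma IsLongDiagonal.interior_convexHull {a b c d : Euc 2} (h : IsLongDiagonal a b c d) :
    interior (convexHull ℝ ({a, b, c, d} : Set (Euc 2))) = openQuad a b c d := by
  apply Set.Subset.antisymm
  · intro p hp
    obtain ⟨⟨h1, h2⟩, ⟨h3, h4⟩, ⟨h5, h6⟩, ⟨h7, h8⟩, -⟩ := h.cross_pos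
    refine ⟨cross_pos_of_mem_interior (ne_of_cross_pos h1) (convexHull_subset_cross_nonneg ?_) hp,
      cross_pos_of_mem_interior (ne_of_cross_pos h3) (convexHull_subset_cross_nonneg ?_) hp,
      cross_pos_of_mem_interior (ne_of_cross_pos h5) (convexHull_subset_cross_nonneg ?_) hp,
      cross_pos_of_mem_interior (ne_of_cross_pos h7) (convexHull_subset_cross_nonneg ?_) hp⟩ <;>
    · rintro q (rfl | rfl | rfl | rfl) <;>
        first | exact (cross_self_left _ _).ge | exact (cross_self_right _ _).ge | linarith
  · apply interior_maximal _ (isOpen_openQuad a b c d)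
    intro p hp
    have hab := h.ne
    obtain ⟨x, y, x', y', hc, hd, hy, hy', ⟨hx0, hx1⟩, ⟨hx0', hx1'⟩⟩ := h.exists_frame
    obtain ⟨u, v, rfl⟩ := exists_eq_frame hab p
    rw [hc, hd, frame_mem_openQuad_iff hab] at hp
    obtain ⟨h1, h2, h3, h4⟩ := hp
    rcases le_total 0 v with hv | hv
    · refine frame_mem_convexHull hy.ne' hc (by simp) (by simp) (by simp) (by positivity) ?_ ?_
      · have : u - x * (v / y) = (y * u - x * v) / y := by field_simp
        rw [this]; positivity
      · have : 1 - u - (1 - x) * (v / y) = (y * (1 - u) - (1 - x) * v) / y := by field_simp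
        rw [this]; positivity
    · refine frame_mem_convexHull hy'.ne hd (by simp) (by simp) (by simp)
        (div_nonneg_of_nonpos hv hy'.le) ?_ ?_
      · have : u - x' * (v / y') = (x' * v - y' * u) / (- y') := by
          field_simp [hy'.ne]; ring
        rw [this]; exact (div_pos h1 (by linarith)).le
      · have : 1 - u - (1 - x') * (v / y') = ((1 - x') * v - y' * (1 - u)) / (- y') := by
          field_simp [hy'.ne]; ring
        rw [this]; exact (div_pos h2 (by linarith)).le

lemma IsLongDiagonal.pairwise_ne {a b c d : Euc 2} (h : IsLongDiagonal a b c d) :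
    a ≠ b ∧ a ≠ c ∧ a ≠ d ∧ b ≠ c ∧ b ≠ d ∧ c ≠ d := by
  obtain ⟨⟨h1, h2⟩, ⟨h3, h4⟩, ⟨h5, h6⟩, ⟨h7, h8⟩, h9, h10⟩ := h.cross_pos
  exact ⟨h.ne, (ne_of_cross_pos h7).symm, ne_of_cross_pos h1, ne_of_cross_pos h5,
    (ne_of_cross_pos h3).symm, ne_of_cross_pos h10⟩

lemma notMem_convexHull_of_cross {a b p : Euc 2} {s : Set (Euc 2)}
    (h : ∀ q ∈ s, 0 ≤ cross a b q) (hp : cross a b p < 0) : p ∉ convexHull ℝ s :=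
  fun hm => absurd (convexHull_subset_cross_nonneg h hm) (not_le.2 hp)

lemma cross_swap (a b p : Euc 2) : cross b a p = - cross a b p := by
  simp only [cross]; ring

lemma IsLongDiagonal.inConvexPosition {a b c d : Euc 2} (h : IsLongDiagonal a b c d) :
    InConvexPosition ({a, b, c, d} : Set (Euc 2)) := by
  obtain ⟨⟨h1, h2⟩, ⟨h3, h4⟩, ⟨h5, h6⟩, ⟨h7, h8⟩, h9, h10⟩ := h.cross_pos
  have hl := h.left
  have hr := h.right
  have s1 := cross_swap c d
  have s2 := cross_swap a b
  have hmem : ∀ p q : Euc 2, q ∈ ({a, b, c, d} : Set (Euc 2)) \ {p} →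
      (q = a ∨ q = b ∨ q = c ∨ q = d) ∧ q ≠ p := fun p q hq => by simpa using hq
  rintro p (rfl | rfl | rfl | rfl)
  · refine notMem_convexHull_of_cross (a := c) (b := d) ?_ (by linarith [s1 p])
    intro q hq
    obtain ⟨rfl | rfl | rfl | rfl, hne⟩ := hmem _ _ hq <;>
      first
        | exact absurd rfl hne | exact (cross_self_left _ _).ge | exact (cross_self_right _ _).ge
        | linarith
  · refine notMem_convexHull_of_cross (a := d) (b := c) ?_ (by linarith [s1 p])
    intro q hq
    obtain ⟨rfl | rfl | rfl | rfl, hne⟩ := hmem _ _ hq <;>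
      first
        | exact absurd rfl hne | exact (cross_self_left _ _).ge | exact (cross_self_right _ _).ge
        | linarith
  · refine notMem_convexHull_of_cross (a := b) (b := a) ?_ (by linarith [s2 p])
    intro q hq
    obtain ⟨rfl | rfl | rfl | rfl, hne⟩ := hmem _ _ hq <;>
      first
        | exact absurd rfl hne | exact (cross_self_left _ _).ge | exact (cross_self_right _ _).ge
        | linarith [s2 q]
  · refine notMem_convexHull_of_cross (a := a) (b := b) ?_ (by linarith [s2 p])
    intro q hq
    obtain ⟨rfl | rfl | rfl | rfl, hne⟩ := hmem _ _ hq <;>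
      first
        | exact absurd rfl hne | exact (cross_self_left _ _).ge | exact (cross_self_right _ _).ge
        | linarith [s2 q]

lemma vertex_notMem_openQuad {a b c d p : Euc 2} (hp : p = a ∨ p = b ∨ p = c ∨ p = d) :
    p ∉ openQuad a b c d := by
  rintro ⟨h1, h2, h3, h4⟩
  rcases hp with rfl | rfl | rfl | rfl <;> simp [cross_self_left, cross_self_right] at *

lemma IsLongDiagonal.openSegment_inter {a b c d : Euc 2} (h : IsLongDiagonal a b c d) :
    (openSegment ℝ a b ∩ openSegment ℝ c d).Nonempty := by
  obtain ⟨x, y, x', y', rfl, rfl, hy, hy', ⟨hx0, hx1⟩, ⟨hx0', hx1'⟩⟩ := h.exists_frame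
  have hD : 0 < y - y' := by linarith
  have p1 := mul_pos hx0 (neg_pos.2 hy')
  have p2 := mul_pos hx0' hy
  have p3 := mul_pos (sub_pos.2 hx1) (neg_pos.2 hy')
  have p4 := mul_pos (sub_pos.2 hx1') hy
  refine ⟨frame a b ((y * x' - y' * x) / (y - y')) 0,
    ⟨1 - (y * x' - y' * x) / (y - y'), (y * x' - y' * x) / (y - y'), ?_, ?_, by ring, ?_⟩,
    ⟨- y' / (y - y'), y / (y - y'), ?_, ?_, by field_simp; ring, ?_⟩⟩
  · rw [sub_pos, div_lt_one hD]; nlinarith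
  · apply div_pos _ hD; nlinarith
  · ext i; fin_cases i <;> simp <;> ring
  · exact div_pos (by linarith) hD
  · positivity
  · ext i; fin_cases i <;> simp <;> field_simp <;> ring

lemma mem_segment_of_cross_eq_zero {a b c : Euc 2} (hab : a ≠ b) (h : cross a b c = 0)
    (hac : dist a c ≤ dist a b) (hbc : dist b c ≤ dist a b) : c ∈ segment ℝ a b := by
  obtain ⟨x, y, rfl⟩ := exists_eq_frame hab c
  have h0 := dist_frame_le_iff hab 0 0 x y
  have h1 := dist_frame_le_iff hab 1 0 x y
  rw [frame_zero_zero] at h0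
  rw [frame_one_zero] at h1
  have hac := h0.1 hac
  have hbc := h1.1 hbc
  have hy : y = 0 := by
    rw [cross_frame_base] at h
    exact (mul_eq_zero.1 h).resolve_left (dist_sq_pos hab).ne'
  subst hy
  refine ⟨1 - x, x, by nlinarith, by nlinarith, by ring, ?_⟩
  ext i; fin_cases i <;> simp <;> ring

lemma cross_combo (a b p q : Euc 2) {s t : ℝ} (hst : s + t = 1) :
    cross a b (s • p + t • q) = s * cross a b p + t * cross a b q := by
  obtain rfl : t = 1 - s := by linarith
  simp only [cross, PiLp.add_apply, PiLp.smul_apply, smul_eq_mul]; ring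

/-- A quadrilateral in convex position whose longest segment `ab` crosses `cd` is a long-diagonal
quadruple, for one of the two orders of `c` and `d`. -/
lemma isLongDiagonal_or_of_crossing {a b c d : Euc 2} (hab : a ≠ b) (hac : a ≠ c) (had : a ≠ d)
    (hbc : b ≠ c) (hbd : b ≠ d) (hpos : InConvexPosition ({a, b, c, d} : Set (Euc 2)))
    (hmax : ∀ p ∈ ({a, b, c, d} : Set (Euc 2)), ∀ q ∈ ({a, b, c, d} : Set (Euc 2)),
      dist p q ≤ dist a b)
    (hcr : (openSegment ℝ a b ∩ openSegment ℝ c d).Nonempty) :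
    IsLongDiagonal a b c d ∨ IsLongDiagonal a b d c := by
  have key : ∀ r ∈ ({a, b, c, d} : Set (Euc 2)), a ≠ r → b ≠ r → cross a b r ≠ 0 := by
    intro r hr har hbr h0
    have := mem_segment_of_cross_eq_zero hab h0 (hmax _ (by simp) _ hr) (hmax _ (by simp) _ hr)
    refine hpos r hr (segment_subset_convexHull ?_ ?_ this) <;> simp [har, hbr]
  have hc := key c (by simp) hac hbc
  have hd := key d (by simp) had hbd
  obtain ⟨z, ⟨s, t, hs, ht, hst, rfl⟩, ⟨s', t', hs', ht', hst', hz⟩⟩ := hcr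
  have h := congrArg (cross a b) hz
  rw [cross_combo _ _ _ _ hst, cross_combo _ _ _ _ hst', cross_self_left, cross_self_right] at h
  have hsign : (0 < cross a b c ∧ cross a b d < 0) ∨ (0 < cross a b d ∧ cross a b c < 0) := by
    rcases lt_or_gt_of_ne hc with h1 | h1 <;> rcases lt_or_gt_of_ne hd with h2 | h2
    · nlinarith [mul_neg_of_pos_of_neg hs' h1, mul_neg_of_pos_of_neg ht' h2]
    · exact Or.inr ⟨h2, h1⟩
    · exact Or.inl ⟨h1, h2⟩
    · nlinarith [mul_pos hs' h1, mul_pos ht' h2]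
  rcases hsign with ⟨h1, h2⟩ | ⟨h1, h2⟩
  · left; constructor <;> first | assumption | (apply hmax <;> simp)
  · right; constructor <;> first | assumption | (apply hmax <;> simp)

lemma IsLongDiagonal.dist_le {a b c d : Euc 2} (h : IsLongDiagonal a b c d) :
    ∀ p ∈ ({a, b, c, d} : Set (Euc 2)), ∀ q ∈ ({a, b, c, d} : Set (Euc 2)),
      dist p q ≤ dist a b := by
  obtain ⟨-, -, h3, h4, h5, h6, h7⟩ := h
  rintro p (rfl | rfl | rfl | rfl) q (rfl | rfl | rfl | rfl) <;>
    first
    | assumption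
    | (rw [dist_comm]; assumption)
    | (rw [dist_self]; exact dist_nonneg)
    | rfl
    | exact (dist_comm _ _).le

/-- Given the longest segment, a long-diagonal quadruple is determined by its set of points. -/
lemma IsLongDiagonal.eq_of_same_base {a b c d c' d' : Euc 2} (h : IsLongDiagonal a b c d)
    (h' : IsLongDiagonal a b c' d')
    (hset : ({a, b, c', d'} : Set (Euc 2)) = {a, b, c, d}) : c' = c ∧ d' = d := by
  have hc : c' ∈ ({a, b, c, d} : Set (Euc 2)) := hset ▸ (by simp)
  have hd : d' ∈ ({a, b, c, d} : Set (Euc 2)) := hset ▸ (by simp)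
  have l := h.left
  have r := h.right
  have l' := h'.left
  have r' := h'.right
  constructor
  · rcases hc with rfl | rfl | rfl | rfl
    · simp [cross_self_left] at l'
    · simp [cross_self_right] at l'
    · rfl
    · linarith
  · rcases hd with rfl | rfl | rfl | rfl
    · simp [cross_self_left] at r'
    · simp [cross_self_right] at r'
    · linarith
    · rfl

lemma IsLongDiagonal.eq_or_eq_swap {a b c d a' b' c' d' : Euc 2} (h : IsLongDiagonal a b c d)
    (h' : IsLongDiagonal a' b' c' d')
    (hset : ({a', b', c', d'} : Set (Euc 2)) = {a, b, c, d})
    (hgen : dist a' b' = dist a b → (a' = a ∧ b' = b) ∨ (a' = b ∧ b' = a)) :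
    (a' = a ∧ b' = b ∧ c' = c ∧ d' = d) ∨ (a' = b ∧ b' = a ∧ c' = d ∧ d' = c) := by
  have hle : dist a' b' ≤ dist a b := h.dist_le _ (hset ▸ by simp) _ (hset ▸ by simp)
  have hge : dist a b ≤ dist a' b' := h'.dist_le _ (hset ▸ by simp) _ (hset ▸ by simp)
  rcases hgen (le_antisymm hle hge) with ⟨rfl, rfl⟩ | ⟨rfl, rfl⟩
  · obtain ⟨rfl, rfl⟩ := h.eq_of_same_base h' hset
    exact Or.inl ⟨rfl, rfl, rfl, rfl⟩
  · have : ({a', b', c', d'} : Set (Euc 2)) = {a', b', d, c} := by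
      rw [hset]; ext z; simp only [Set.mem_insert_iff, Set.mem_singleton_iff]; tauto
    obtain ⟨rfl, rfl⟩ := h.symm.eq_of_same_base h' this
    exact Or.inr ⟨rfl, rfl, rfl, rfl⟩

/-- The configurations in which the points selected by `e` form a long-diagonal quadruple
whose open quadrilateral avoids all the other points. -/
def emptyQuadEvent {n : ℕ} (e : Fin 2 ⊕ Fin 2 ↪ Fin n) : Set (Fin n → Euc 2) :=
  {x | IsLongDiagonal (x (e (.inl 0))) (x (e (.inl 1))) (x (e (.inr 0))) (x (e (.inr 1))) ∧
    ∀ m ∉ Set.range e, x m ∉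
      openQuad (x (e (.inl 0))) (x (e (.inl 1))) (x (e (.inr 0))) (x (e (.inr 1)))}

/-- The distances between the points are pairwise distinct. -/
def DistinctDist {n : ℕ} (x : Fin n → Euc 2) : Prop :=
  ∀ i j k l, i ≠ j → i ≠ k → i ≠ l → dist (x i) (x j) ≠ dist (x k) (x l)

lemma DistinctDist.injective {n : ℕ} {x : Fin n → Euc 2} (hx : DistinctDist x) :
    Function.Injective x := by
  intro i j hij
  by_contra hne
  exact hx i j j j hne hne hne (by rw [hij])

lemma DistinctDist.eq_or_swap {n : ℕ} {x : Fin n → Euc 2} (hx : DistinctDist x) {i j k l : Fin n}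
    (hij : i ≠ j) (h : dist (x i) (x j) = dist (x k) (x l)) :
    (i = k ∧ j = l) ∨ (i = l ∧ j = k) := by
  have h1 : i = k ∨ i = l := by
    by_contra! hne
    exact hx i j k l hij hne.1 hne.2 h
  have h2 : j = k ∨ j = l := by
    by_contra! hne
    exact hx j i k l hij.symm hne.1 hne.2 (by rwa [dist_comm])
  rcases h1 with rfl | rfl <;> rcases h2 with rfl | rfl <;> simp_all

/-- The embedding exchanging the two points within both pairs. -/
def swapPairs {n : ℕ} (e : Fin 2 ⊕ Fin 2 ↪ Fin n) : Fin 2 ⊕ Fin 2 ↪ Fin n :=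
  ((Equiv.sumCongr (Equiv.swap 0 1) (Equiv.swap 0 1)).toEmbedding).trans e

lemma range_swapPairs {n : ℕ} (e : Fin 2 ⊕ Fin 2 ↪ Fin n) :
    Set.range (swapPairs e) = Set.range e :=
  EquivLike.range_comp e (Equiv.sumCongr (Equiv.swap (0 : Fin 2) 1) (Equiv.swap (0 : Fin 2) 1))

lemma openQuad_symm (a b c d : Euc 2) : openQuad b a d c = openQuad a b c d := by
  ext p; simp only [openQuad, Set.mem_ofPred_eq]; tauto

lemma mem_emptyQuadEvent_swapPairs {n : ℕ} {e : Fin 2 ⊕ Fin 2 ↪ Fin n} {x : Fin n → Euc 2}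
    (h : x ∈ emptyQuadEvent e) : x ∈ emptyQuadEvent (swapPairs e) := by
  refine ⟨h.1.symm, ?_⟩
  rw [range_swapPairs]
  intro m hm
  have := h.2 m hm
  rw [← openQuad_symm] at this
  exact this

open Classical in
/-- The set of points selected by `e`. -/
noncomputable def selected {n : ℕ} (x : Fin n → Euc 2) (e : Fin 2 ⊕ Fin 2 ↪ Fin n) :
    Finset (Euc 2) :=
  {x (e (.inl 0)), x (e (.inl 1)), x (e (.inr 0)), x (e (.inr 1))}

lemma coe_selected {n : ℕ} (x : Fin n → Euc 2) (e : Fin 2 ⊕ Fin 2 ↪ Fin n) :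
    (selected x e : Set (Euc 2)) =
      {x (e (.inl 0)), x (e (.inl 1)), x (e (.inr 0)), x (e (.inr 1))} := by
  simp [selected]

lemma selected_swapPairs {n : ℕ} (x : Fin n → Euc 2) (e : Fin 2 ⊕ Fin 2 ↪ Fin n) :
    selected x (swapPairs e) = selected x e := by
  rw [← Finset.coe_inj, coe_selected, coe_selected]
  simp only [swapPairs, Function.Embedding.trans_apply, Equiv.coe_toEmbedding,
    Equiv.sumCongr_apply, Sum.map_inl, Sum.map_inr, Equiv.swap_apply_left, Equiv.swap_apply_right]
  ext z
  simp only [Set.mem_insert_iff, Set.mem_singleton_iff]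
  tauto

open Classical in
lemma selected_isHole {n : ℕ} {x : Fin n → Euc 2} {e : Fin 2 ⊕ Fin 2 ↪ Fin n}
    (h : x ∈ emptyQuadEvent e) :
    IsHole 4 (Finset.image x Finset.univ) (selected x e) ∧ MaxPairIsDiagonal (selected x e) := by
  obtain ⟨hd, he⟩ := h
  obtain ⟨h1, h2, h3, h4, h5, h6⟩ := hd.pairwise_ne
  have hcard : (selected x e).card = 4 := by
    rw [selected, Finset.card_insert_of_notMem, Finset.card_insert_of_notMem,
      Finset.card_pair h6] <;> simp_all
  refine ⟨⟨?_, hcard, ?_, ?_⟩, ?_⟩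
  · intro p hp
    simp only [selected, Finset.mem_insert, Finset.mem_singleton] at hp
    rcases hp with rfl | rfl | rfl | rfl <;> simp
  · rw [coe_selected]; exact hd.inConvexPosition
  · intro p hp
    obtain ⟨m, -, rfl⟩ := Finset.mem_image.1 hp
    rw [coe_selected, hd.interior_convexHull]
    by_cases hm : m ∈ Set.range e
    · apply vertex_notMem_openQuad
      obtain ⟨i | i, rfl⟩ := hm <;> fin_cases i <;> simp
    · exact he m hm
  · refine ⟨_, _, _, _, rfl, hcard, ?_, hd.openSegment_inter⟩
    intro p hp q hq
    rw [← Finset.mem_coe, coe_selected] at hp hq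
    exact hd.dist_le p hp q hq

open Classical in
lemma exists_selected_eq {n : ℕ} {x : Fin n → Euc 2} {H : Finset (Euc 2)}
    (hH : IsHole 4 (Finset.image x Finset.univ) H) (hM : MaxPairIsDiagonal H) :
    ∃ e : Fin 2 ⊕ Fin 2 ↪ Fin n, x ∈ emptyQuadEvent e ∧ selected x e = H := by
  suffices ∃ a b c d, H = {a, b, c, d} ∧ IsLongDiagonal a b c d by
    obtain ⟨a, b, c, d, rfl, hd⟩ := this
    obtain ⟨h1, h2, h3, h4, h5, h6⟩ := hd.pairwise_ne
    obtain ⟨hsub, -, -, hemp⟩ := hH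
    have hex : ∀ p ∈ ({a, b, c, d} : Finset (Euc 2)), ∃ i, x i = p := fun p hp => by
      simpa using hsub hp
    obtain ⟨i, rfl⟩ := hex a (by simp)
    obtain ⟨j, rfl⟩ := hex b (by simp)
    obtain ⟨k, rfl⟩ := hex c (by simp)
    obtain ⟨l, rfl⟩ := hex d (by simp)
    have hinj : Function.Injective (Sum.elim ![i, j] ![k, l]) := by
      have g1 := ne_of_apply_ne x h1
      have g2 := ne_of_apply_ne x h2
      have g3 := ne_of_apply_ne x h3
      have g4 := ne_of_apply_ne x h4
      have g5 := ne_of_apply_ne x h5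
      have g6 := ne_of_apply_ne x h6
      rintro (p | p) (q | q) <;> fin_cases p <;> fin_cases q <;> simp_all [eq_comm]
    refine ⟨⟨_, hinj⟩, ⟨hd, fun m _ => ?_⟩, rfl⟩
    have := hemp (x m) (by simp)
    simp only [Finset.coe_insert, Finset.coe_singleton] at this
    rw [hd.interior_convexHull] at this
    exact this
  obtain ⟨a, b, c, d, rfl, hcard, hmax, hcr⟩ := hM
  have hne : (a ≠ b ∧ a ≠ c ∧ a ≠ d) ∧ b ≠ c ∧ b ≠ d := by
    have h3 := Finset.card_le_three (a := a) (b := c) (c := d)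
    have h4 := Finset.card_le_three (a := a) (b := b) (c := d)
    have h5 := Finset.card_le_three (a := a) (b := b) (c := c)
    have h6 := Finset.card_le_three (a := b) (b := c) (c := d)
    refine ⟨⟨?_, ?_, ?_⟩, ?_, ?_⟩ <;>
    · rintro rfl
      simp only [Finset.mem_insert, Finset.mem_singleton, true_or, or_true,
        Finset.insert_eq_of_mem] at hcard h3 h4 h5 h6
      omega
  obtain ⟨⟨h1, h2, h3⟩, h4, h5⟩ := hne
  have hpos := hH.2.2.1
  simp only [Finset.coe_insert, Finset.coe_singleton] at hpos
  rcases isLongDiagonal_or_of_crossing h1 h2 h3 h4 h5 hpos (by simpa using hmax) hcr with h | h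
  · exact ⟨a, b, c, d, rfl, h⟩
  · exact ⟨a, b, d, c, by rw [Finset.pair_comm], h⟩

open Classical in
/-- Every hole counted by `holeCountDiag` is selected by exactly two embeddings. -/
lemma two_mul_holeCountDiag {n : ℕ} {x : Fin n → Euc 2} (hx : DistinctDist x) :
    2 * holeCountDiag n x =
      (Finset.univ.filter fun e : Fin 2 ⊕ Fin 2 ↪ Fin n => x ∈ emptyQuadEvent e).card := by
  have hmaps : ∀ e ∈ Finset.univ.filter fun e : Fin 2 ⊕ Fin 2 ↪ Fin n => x ∈ emptyQuadEvent e,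
      selected x e ∈ (Finset.image x Finset.univ).powerset.filter
        (fun H => IsHole 4 (Finset.image x Finset.univ) H ∧ MaxPairIsDiagonal H) := by
    intro e he
    have h := selected_isHole (Finset.mem_filter.1 he).2
    exact Finset.mem_filter.2 ⟨Finset.mem_powerset.2 h.1.1, h⟩
  rw [Finset.card_eq_sum_card_fiberwise hmaps, holeCountDiag, mul_comm, ← smul_eq_mul]
  refine (Finset.sum_const _).symm.trans (Finset.sum_congr rfl fun H hH => ?_)
  obtain ⟨-, hH, hM⟩ := Finset.mem_filter.1 hH
  obtain ⟨e, he, rfl⟩ := exists_selected_eq hH hM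
  symm
  rw [Finset.card_eq_two]
  refine ⟨e, swapPairs e, ?_, ?_⟩
  · intro h
    have := e.injective (DFunLike.congr_fun h (.inl 0))
    simp at this
  · ext f
    simp only [Finset.mem_filter, Finset.mem_univ, true_and, Finset.mem_insert,
      Finset.mem_singleton]
    constructor
    · rintro ⟨hf, hs⟩
      have hset := congrArg (fun s : Finset (Euc 2) => (s : Set (Euc 2))) hs
      simp only [coe_selected] at hset
      rcases he.1.eq_or_eq_swap hf.1 hset (fun hdist => by
        have := hx.eq_or_swap (f.injective.ne (by simp)) hdist
        rcases this with ⟨h1, h2⟩ | ⟨h1, h2⟩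
        · left; rw [h1, h2]; simp
        · right; rw [h1, h2]; simp) with h | h
      · left
        obtain ⟨h1, h2, h3, h4⟩ := h
        ext1 (i | i) <;> fin_cases i <;> apply hx.injective <;> assumption
      · right
        obtain ⟨h1, h2, h3, h4⟩ := h
        ext1 (i | i) <;> fin_cases i <;> apply hx.injective <;> simpa [swapPairs]
    · rintro (rfl | rfl)
      · exact ⟨he, rfl⟩
      · exact ⟨mem_emptyQuadEvent_swapPairs he, selected_swapPairs x e⟩

open scoped ENNReal

/-- The frame coordinates, with the second one rescaled by `k`, multiply areas by
`dist a b ^ 2 * |k|`. -/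
lemma map_frame_volume {a b : Euc 2} (hab : a ≠ b) {k : ℝ} (hk : k ≠ 0) :
    Measure.map (fun q : ℝ × ℝ => frame a b q.1 (k * q.2)) volume =
      ENNReal.ofReal (dist a b ^ 2 * |k|)⁻¹ • (volume : Measure (Euc 2)) := by
  have hL := dist_sq_pos hab
  let M : Matrix (Fin 2) (Fin 2) ℝ :=
    !![b 0 - a 0, - (k * (b 1 - a 1)); b 1 - a 1, k * (b 0 - a 0)]
  have hdet : M.det = dist a b ^ 2 * k := by
    rw [dist_sq_eq, Matrix.det_fin_two_of]; ring
  have hdet0 : M.det ≠ 0 := by rw [hdet]; positivity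
  have hM := Real.map_matrix_volume_pi_eq_smul_volume_pi hdet0
  have h1 := (volume_preserving_finTwoArrow ℝ).symm
  have h2 := PiLp.volume_preserving_toLp (Fin 2)
  have h3 := measurePreserving_add_left (volume : Measure (Euc 2)) a
  have hMm : Measurable (Matrix.toLin' M) :=
    (LinearMap.continuous_of_finiteDimensional _).measurable
  have hcomp : (fun q : ℝ × ℝ => frame a b q.1 (k * q.2)) =
      (fun p => a + p) ∘ (WithLp.toLp 2) ∘ (Matrix.toLin' M) ∘
        (MeasurableEquiv.finTwoArrow (α := ℝ)).symm := by
    funext q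
    ext i
    fin_cases i <;>
      simp [M, MeasurableEquiv.finTwoArrow,
        Matrix.vecHead, Matrix.vecTail] <;> ring
  rw [hcomp, ← Measure.map_map h3.measurable (h2.measurable.comp (hMm.comp h1.measurable)),
    ← Measure.map_map h2.measurable (hMm.comp h1.measurable),
    ← Measure.map_map hMm h1.measurable, h1.map_eq, hM, Measure.map_smul, h2.map_eq,
    Measure.map_smul, h3.map_eq, hdet, abs_inv, abs_mul, abs_of_pos hL]

lemma lintegral_frame {a b : Euc 2} (hab : a ≠ b) {k : ℝ} (hk : k ≠ 0) {f : Euc 2 → ℝ≥0∞}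
    (hf : Measurable f) :
    ∫⁻ p, f p = ENNReal.ofReal (dist a b ^ 2 * |k|) *
      ∫⁻ q : ℝ × ℝ, f (frame a b q.1 (k * q.2)) := by
  have hL := dist_sq_pos hab
  have hpos : 0 < dist a b ^ 2 * |k| := by positivity
  have hm : Measurable (fun q : ℝ × ℝ => frame a b q.1 (k * q.2)) := by
    have : Continuous (fun q : ℝ × ℝ => frame a b q.1 (k * q.2)) := by unfold frame; fun_prop
    exact this.measurable
  rw [← lintegral_map hf hm, map_frame_volume hab hk, lintegral_smul_measure, smul_eq_mul,
    ← mul_assoc, ← ENNReal.ofReal_mul hpos.le, mul_inv_cancel₀ hpos.ne', ENNReal.ofReal_one,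
    one_mul]

lemma lintegral_one_sub_div {y : ℝ} (hy : 0 < y) :
    ∫⁻ v in Set.Ioi (0 : ℝ), ENNReal.ofReal (1 - v / y) = ENNReal.ofReal (y / 2) := by
  have h1 : ∫⁻ v in Set.Ioi (0 : ℝ), ENNReal.ofReal (1 - v / y) =
      ∫⁻ v in Set.Ioc (0 : ℝ) y, ENNReal.ofReal (1 - v / y) := by
    rw [← Set.Ioc_union_Ioi_eq_Ioi hy.le, lintegral_union measurableSet_Ioi]
    · rw [setLIntegral_congr_fun (g := fun _ => 0) measurableSet_Ioi]
      · simp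
      · intro v hv
        have : y < v := hv
        simp only [ENNReal.ofReal_eq_zero, sub_nonpos]
        rw [one_le_div hy]; exact this.le
    · exact Set.Ioc_disjoint_Ioi le_rfl
  rw [h1, ← ofReal_integral_eq_lintegral_ofReal, ← intervalIntegral.integral_of_le hy.le]
  · congr 1
    rw [intervalIntegral.integral_sub (by simp) (by apply Continuous.intervalIntegrable; fun_prop)]
    simp
    field_simp
    ring
  · apply Continuous.integrableOn_Ioc; fun_prop
  · filter_upwards [ae_restrict_mem measurableSet_Ioc] with v hv
    have : v / y ≤ 1 := (div_le_one hy).2 hv.2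
    simp only [Pi.zero_apply]; linarith

/-- The area of a convex quadrilateral with a diagonal on the first axis. -/
lemma volume_planar_quad {x y x' y' : ℝ} (hy : 0 < y) (hy' : y' < 0)
    (hx : x ∈ Set.Ioo (0 : ℝ) 1) (hx' : x' ∈ Set.Ioo (0 : ℝ) 1) :
    volume {q : ℝ × ℝ | 0 < x' * q.2 - y' * q.1 ∧ 0 < (1 - x') * q.2 - y' * (1 - q.1) ∧
        0 < y * (1 - q.1) - (1 - x) * q.2 ∧ 0 < y * q.1 - x * q.2} =
      ENNReal.ofReal ((y - y') / 2) := by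
  set S := {q : ℝ × ℝ | 0 < x' * q.2 - y' * q.1 ∧ 0 < (1 - x') * q.2 - y' * (1 - q.1) ∧
        0 < y * (1 - q.1) - (1 - x) * q.2 ∧ 0 < y * q.1 - x * q.2} with hS
  obtain ⟨hx0, hx1⟩ := hx
  obtain ⟨hx0', hx1'⟩ := hx'
  have hSm : MeasurableSet S := by
    apply IsOpen.measurableSet
    have hopen {f : ℝ × ℝ → ℝ} (hf : Continuous f) : IsOpen {q | 0 < f q} :=
      isOpen_lt continuous_const hf
    exact (hopen (by fun_prop)).and ((hopen (by fun_prop)).and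
      ((hopen (by fun_prop)).and (hopen (by fun_prop))))
  have hpos : ∀ v, 0 < v → volume ((fun u => (u, v)) ⁻¹' S) = ENNReal.ofReal (1 - v / y) := by
    intro v hv
    have : (fun u => (u, v)) ⁻¹' S = Set.Ioo (x * v / y) (1 - (1 - x) * v / y) := by
      ext u
      have e1 : x * v / y < u ↔ 0 < y * u - x * v := by
        rw [div_lt_iff₀ hy]; constructor <;> intro h <;> linarith
      have e2 : u < 1 - (1 - x) * v / y ↔ 0 < y * (1 - u) - (1 - x) * v := by
        rw [lt_sub_comm, div_lt_iff₀ hy]; constructor <;> intro h <;> linarith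
      rw [Set.mem_Ioo, e1, e2]
      constructor
      · rintro ⟨-, -, h3, h4⟩; exact ⟨h4, h3⟩
      · rintro ⟨h4, h3⟩
        have hu : 0 < u := by
          have : 0 < x * v := mul_pos hx0 hv
          by_contra! hu; nlinarith
        have hu' : u < 1 := by
          have : 0 < (1 - x) * v := mul_pos (by linarith) hv
          by_contra! hu; nlinarith
        refine ⟨?_, ?_, h3, h4⟩ <;> simp only
        · nlinarith [mul_pos hx0' hv, mul_pos hu (neg_pos.2 hy')]
        · nlinarith [mul_pos (sub_pos.2 hx1') hv, mul_pos (sub_pos.2 hu') (neg_pos.2 hy')]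
    rw [this, Real.volume_Ioo]
    congr 1; field_simp; ring
  have hneg : ∀ v, v < 0 → volume ((fun u => (u, v)) ⁻¹' S) = ENNReal.ofReal (1 - v / y') := by
    intro v hv
    have : (fun u => (u, v)) ⁻¹' S = Set.Ioo (x' * v / y') (1 - (1 - x') * v / y') := by
      ext u
      have e1 : x' * v / y' < u ↔ 0 < x' * v - y' * u := by
        rw [div_lt_iff_of_neg hy']; constructor <;> intro h <;> linarith
      have e2 : u < 1 - (1 - x') * v / y' ↔ 0 < (1 - x') * v - y' * (1 - u) := by
        rw [lt_sub_comm, div_lt_iff_of_neg hy']; constructor <;> intro h <;> linarith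
      rw [Set.mem_Ioo, e1, e2]
      constructor
      · rintro ⟨h1, h2, -, -⟩; exact ⟨h1, h2⟩
      · rintro ⟨h1, h2⟩
        have hu : 0 < u := by
          have : 0 < x' * (-v) := mul_pos hx0' (neg_pos.2 hv)
          by_contra! hu; nlinarith
        have hu' : u < 1 := by
          have : 0 < (1 - x') * (-v) := mul_pos (by linarith) (neg_pos.2 hv)
          by_contra! hu; nlinarith
        refine ⟨h1, h2, ?_, ?_⟩ <;> simp only
        · nlinarith [mul_pos (sub_pos.2 hx1) (neg_pos.2 hv), mul_pos (sub_pos.2 hu') hy]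
        · nlinarith [mul_pos hx0 (neg_pos.2 hv), mul_pos hu hy]
    rw [this, Real.volume_Ioo]
    congr 1; field_simp [hy'.ne]; ring
  have hintg : ∫⁻ v in Set.Iio (0 : ℝ), ENNReal.ofReal (1 - v / y') =
      ENNReal.ofReal (-y' / 2) := by
    rw [← lintegral_one_sub_div (neg_pos.2 hy'),
      ← (Measure.measurePreserving_neg (volume : Measure ℝ)).setLIntegral_comp_preimage
        measurableSet_Ioi (by fun_prop)]
    simp [neg_div_neg_eq]
  rw [Measure.volume_eq_prod, Measure.prod_apply_symm hSm,
    ← lintegral_add_compl _ (measurableSet_Ioi (a := (0 : ℝ))), Set.compl_Ioi,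
    setLIntegral_congr Iio_ae_eq_Iic.symm, setLIntegral_congr_fun measurableSet_Ioi hpos,
    setLIntegral_congr_fun measurableSet_Iio hneg, lintegral_one_sub_div hy, hintg,
    ← ENNReal.ofReal_add (by linarith) (by linarith)]
  congr 1; ring

lemma volume_openQuad_frame {a b : Euc 2} (hab : a ≠ b) {x y x' y' : ℝ} (hy : 0 < y)
    (hy' : y' < 0) (hx : x ∈ Set.Ioo (0 : ℝ) 1) (hx' : x' ∈ Set.Ioo (0 : ℝ) 1) :
    volume (openQuad a b (frame a b x y) (frame a b x' y')) =
      ENNReal.ofReal (dist a b ^ 2 * (y - y') / 2) := by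
  have hm := (isOpen_openQuad a b (frame a b x y) (frame a b x' y')).measurableSet
  have hfm : Measurable (fun q : ℝ × ℝ => frame a b q.1 (1 * q.2)) := by
    have : Continuous (fun q : ℝ × ℝ => frame a b q.1 (1 * q.2)) := by unfold frame; fun_prop
    exact this.measurable
  rw [← lintegral_indicator_one hm, lintegral_frame hab one_ne_zero (measurable_one.indicator hm)]
  have : (fun q : ℝ × ℝ => (openQuad a b (frame a b x y) (frame a b x' y')).indicator
      (1 : Euc 2 → ℝ≥0∞) (frame a b q.1 (1 * q.2))) =
      ((fun q : ℝ × ℝ => frame a b q.1 (1 * q.2)) ⁻¹'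
        (openQuad a b (frame a b x y) (frame a b x' y'))).indicator 1 := rfl
  rw [this, lintegral_indicator_one (hfm hm)]
  have hset : ((fun q : ℝ × ℝ => frame a b q.1 (1 * q.2)) ⁻¹'
        (openQuad a b (frame a b x y) (frame a b x' y'))) =
      {q : ℝ × ℝ | 0 < x' * q.2 - y' * q.1 ∧ 0 < (1 - x') * q.2 - y' * (1 - q.1) ∧
        0 < y * (1 - q.1) - (1 - x) * q.2 ∧ 0 < y * q.1 - x * q.2} := by
    ext q
    simp only [Set.mem_preimage, one_mul, frame_mem_openQuad_iff hab, Set.mem_ofPred_eq]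
  rw [hset, volume_planar_quad hy hy' hx hx', ← ENNReal.ofReal_mul (by positivity)]
  congr 1; rw [abs_one]; ring

lemma ae_distinctDist {μ : Measure (Euc 2)} [IsProbabilityMeasure μ]
    (hμ : ∀ p r, μ (Metric.sphere p r) = 0) (n : ℕ) :
    ∀ᵐ x ∂(Measure.pi fun _ : Fin n => μ), DistinctDist x := by
  unfold DistinctDist
  simp only [ae_all_iff]
  intro i j k l hij hik hil
  obtain _ | n := n
  · exact i.elim0
  obtain ⟨j, rfl⟩ := Fin.exists_succAbove_eq hij.symm
  obtain ⟨k, rfl⟩ := Fin.exists_succAbove_eq hik.symm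
  obtain ⟨l, rfl⟩ := Fin.exists_succAbove_eq hil.symm
  have hmp := measurePreserving_piFinSuccAbove (fun _ : Fin (n + 1) => μ) i
  have hae : ∀ᵐ w ∂(μ.prod (Measure.pi fun _ : Fin n => μ)),
      dist w.1 (w.2 j) ≠ dist (w.2 k) (w.2 l) := by
    have hm : MeasurableSet {w : Euc 2 × (Fin n → Euc 2) |
        dist w.1 (w.2 j) = dist (w.2 k) (w.2 l)} :=
      measurableSet_eq_fun (by fun_prop) (by fun_prop)
    rw [ae_iff]
    simp only [ne_eq, not_not]
    rw [Measure.prod_apply_symm hm]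
    simp only [lintegral_eq_zero_iff (measurable_measure_prodMk_right hm)]
    exact Eventually.of_forall fun z => hμ (z j) (dist (z k) (z l))
  exact hmp.quasiMeasurePreserving.ae hae

lemma continuous_cross : Continuous fun w : Euc 2 × Euc 2 × Euc 2 => cross w.1 w.2.1 w.2.2 := by
  unfold cross; fun_prop

lemma continuous_cross_comp {X : Type*} [TopologicalSpace X] {f g h : X → Euc 2}
    (hf : Continuous f) (hg : Continuous g) (hh : Continuous h) :
    Continuous fun w => cross (f w) (g w) (h w) :=
  continuous_cross.comp (hf.prodMk (hg.prodMk hh))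

/-- The long-diagonal quadruples, as a set of pairs of pairs. -/
def longDiagonals : Set ((Euc 2 × Euc 2) × (Euc 2 × Euc 2)) :=
  {w | IsLongDiagonal w.1.1 w.1.2 w.2.1 w.2.2}

lemma measurableSet_longDiagonals : MeasurableSet longDiagonals := by
  have hpos {f : (Euc 2 × Euc 2) × (Euc 2 × Euc 2) → ℝ} (hf : Continuous f) :
      MeasurableSet {w | 0 < f w} := (isOpen_lt continuous_const hf).measurableSet
  have hneg {f : (Euc 2 × Euc 2) × (Euc 2 × Euc 2) → ℝ} (hf : Continuous f) :
      MeasurableSet {w | f w < 0} := (isOpen_lt hf continuous_const).measurableSet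
  have hle {f : (Euc 2 × Euc 2) × (Euc 2 × Euc 2) → ℝ} (hf : Continuous f) :
      MeasurableSet {w | f w ≤ dist w.1.1 w.1.2} :=
    (isClosed_le hf (by fun_prop)).measurableSet
  have : longDiagonals =
      {w | 0 < cross w.1.1 w.1.2 w.2.1} ∩ ({w | cross w.1.1 w.1.2 w.2.2 < 0} ∩
      ({w | dist w.1.1 w.2.1 ≤ dist w.1.1 w.1.2} ∩ ({w | dist w.1.2 w.2.1 ≤ dist w.1.1 w.1.2} ∩
      ({w | dist w.1.1 w.2.2 ≤ dist w.1.1 w.1.2} ∩ ({w | dist w.1.2 w.2.2 ≤ dist w.1.1 w.1.2} ∩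
      {w | dist w.2.1 w.2.2 ≤ dist w.1.1 w.1.2}))))) := by
    ext w
    exact ⟨fun ⟨h1, h2, h3, h4, h5, h6, h7⟩ => ⟨h1, h2, h3, h4, h5, h6, h7⟩,
      fun ⟨h1, h2, h3, h4, h5, h6, h7⟩ => ⟨h1, h2, h3, h4, h5, h6, h7⟩⟩
  rw [this]
  exact (hpos (continuous_cross_comp (by fun_prop) (by fun_prop) (by fun_prop))).inter
    ((hneg (continuous_cross_comp (by fun_prop) (by fun_prop) (by fun_prop))).inter
    ((hle (by fun_prop)).inter ((hle (by fun_prop)).inter ((hle (by fun_prop)).inter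
    ((hle (by fun_prop)).inter (hle (by fun_prop)))))))

lemma measurableSet_openQuad :
    MeasurableSet {w : ((Euc 2 × Euc 2) × (Euc 2 × Euc 2)) × Euc 2 |
      w.2 ∈ openQuad w.1.1.1 w.1.1.2 w.1.2.1 w.1.2.2} := by
  have hpos {f : ((Euc 2 × Euc 2) × (Euc 2 × Euc 2)) × Euc 2 → ℝ} (hf : Continuous f) :
      IsOpen {w | 0 < f w} := isOpen_lt continuous_const hf
  exact ((hpos (continuous_cross_comp (by fun_prop) (by fun_prop) (by fun_prop))).and
    ((hpos (continuous_cross_comp (by fun_prop) (by fun_prop) (by fun_prop))).and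
    ((hpos (continuous_cross_comp (by fun_prop) (by fun_prop) (by fun_prop))).and
    (hpos (continuous_cross_comp (by fun_prop) (by fun_prop) (by fun_prop)))))).measurableSet

/-- The conditional probability that `m` further points avoid the open quadrilateral, set to zero
outside of the long-diagonal quadruples. -/
noncomputable def avoidProb (μ : Measure (Euc 2)) (m : ℕ) :
    (Euc 2 × Euc 2) × (Euc 2 × Euc 2) → ℝ≥0∞ :=
  longDiagonals.indicator fun w => (1 - μ (openQuad w.1.1 w.1.2 w.2.1 w.2.2)) ^ m

lemma measurable_avoidProb (μ : Measure (Euc 2)) [IsProbabilityMeasure μ] (m : ℕ) :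
    Measurable (avoidProb μ m) := by
  refine Measurable.indicator ?_ measurableSet_longDiagonals
  exact (measurable_const.sub (measurable_measure_prodMk_left measurableSet_openQuad)).pow_const m

/-- An embedding of `Fin 2 ⊕ Fin 2` extends to an enumeration of the whole index set. -/
lemma exists_equiv_extending {n : ℕ} (e : Fin 2 ⊕ Fin 2 ↪ Fin n) :
    ∃ σ : (Fin 2 ⊕ Fin 2) ⊕ Fin (n - 4) ≃ Fin n, ∀ i, σ (.inl i) = e i := by
  classical
  have hcard : Fintype.card ↥(Set.range e)ᶜ = n - 4 := by
    rw [Fintype.card_compl_set, Set.card_range_of_injective e.injective]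
    simp
  let τ : Fin (n - 4) ≃ ↥(Set.range e)ᶜ := (Fintype.equivFinOfCardEq hcard).symm
  exact ⟨((Equiv.ofInjective e e.injective).sumCongr τ).trans (Equiv.Set.sumCompl _),
    fun i => by simp⟩

lemma measurePreserving_select (μ : Measure (Euc 2)) [IsProbabilityMeasure μ] {n m : ℕ}
    (σ : (Fin 2 ⊕ Fin 2) ⊕ Fin m ≃ Fin n) :
    MeasurePreserving (fun x : Fin n → Euc 2 =>
      (((x (σ (.inl (.inl 0))), x (σ (.inl (.inl 1)))),
        (x (σ (.inl (.inr 0))), x (σ (.inl (.inr 1))))), fun j => x (σ (.inr j))))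
      (Measure.pi fun _ : Fin n => μ)
      (((μ.prod μ).prod (μ.prod μ)).prod (Measure.pi fun _ : Fin m => μ)) := by
  have h1 := (measurePreserving_piCongrLeft (fun _ : Fin n => μ) σ).symm
  have h2 := measurePreserving_sumPiEquivProdPi
    (fun _ : (Fin 2 ⊕ Fin 2) ⊕ Fin m => μ)
  have h3 := measurePreserving_sumPiEquivProdPi (fun _ : Fin 2 ⊕ Fin 2 => μ)
  have h4 := measurePreserving_finTwoArrow μ
  have h5 := ((((h4.prod h4).comp h3).prod
    (MeasurePreserving.id (Measure.pi fun _ : Fin m => μ))).comp h2).comp h1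
  exact h5

lemma measure_emptyQuadEvent (μ : Measure (Euc 2)) [IsProbabilityMeasure μ] {n : ℕ}
    (e : Fin 2 ⊕ Fin 2 ↪ Fin n) :
    MeasurableSet (emptyQuadEvent e) ∧ (Measure.pi fun _ : Fin n => μ) (emptyQuadEvent e) =
      ∫⁻ w, avoidProb μ (n - 4) w ∂((μ.prod μ).prod (μ.prod μ)) := by
  obtain ⟨σ, hσ⟩ := exists_equiv_extending e
  have hmp := measurePreserving_select μ σ
  let D : Set (((Euc 2 × Euc 2) × (Euc 2 × Euc 2)) × (Fin (n - 4) → Euc 2)) :=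
    Prod.fst ⁻¹' longDiagonals ∩
      ⋂ j, {w | w.2 j ∈ openQuad w.1.1.1 w.1.1.2 w.1.2.1 w.1.2.2}ᶜ
  have hD : MeasurableSet D := by
    refine (measurable_fst measurableSet_longDiagonals).inter (MeasurableSet.iInter fun j => ?_)
    have hj : Measurable fun w : ((Euc 2 × Euc 2) × (Euc 2 × Euc 2)) × (Fin (n - 4) → Euc 2) =>
      (w.1, w.2 j) := by fun_prop
    exact (hj measurableSet_openQuad).compl
  have hpre : emptyQuadEvent e = (fun x : Fin n → Euc 2 =>
      (((x (σ (.inl (.inl 0))), x (σ (.inl (.inl 1)))),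
        (x (σ (.inl (.inr 0))), x (σ (.inl (.inr 1))))), fun j => x (σ (.inr j)))) ⁻¹' D := by
    ext x
    simp only [emptyQuadEvent, D, hσ, longDiagonals, Set.mem_preimage, Set.mem_inter_iff,
      Set.mem_iInter, Set.mem_compl_iff, Set.mem_ofPred_eq]
    refine and_congr_right fun _ => ⟨fun h j => h _ ?_, fun h k hk => ?_⟩
    · rintro ⟨i, hi⟩
      rw [← hσ] at hi
      simpa using σ.injective hi
    · obtain ⟨i | j, rfl⟩ := σ.surjective k
      · exact absurd ⟨i, (hσ i).symm⟩ hk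
      · exact h j
  rw [hpre]
  refine ⟨hmp.measurable hD, ?_⟩
  rw [hmp.measure_preimage hD.nullMeasurableSet, Measure.prod_apply hD]
  refine lintegral_congr fun w => ?_
  by_cases hw : w ∈ longDiagonals
  · have : Prod.mk w ⁻¹' D =
        Set.univ.pi fun _ : Fin (n - 4) => (openQuad w.1.1 w.1.2 w.2.1 w.2.2)ᶜ := by
      ext z
      simp [D, hw]
    rw [this, Measure.pi_pi, avoidProb, Set.indicator_of_mem hw,
      prob_compl_eq_one_sub (isOpen_openQuad _ _ _ _).measurableSet]
    simp
  · have : Prod.mk w ⁻¹' D = ∅ := by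
      ext z
      simp [D, hw]
    rw [this, avoidProb, Set.indicator_of_notMem hw, measure_empty]

lemma unif_eq_restrict {K : Set (Euc 2)} (hvol : volume K = 1) : unif K = volume.restrict K := by
  simp [unif, hvol]

/-- The expected number of holes in terms of the avoidance probability. -/
lemma EHdiag_eq {K : Set (Euc 2)} (hvol : volume K = 1) (n : ℕ) :
    EHdiag K n = (n.descFactorial 4 : ℝ) / 2 *
      (∫⁻ w, avoidProb (volume.restrict K) (n - 4) w
        ∂(((volume.restrict K).prod (volume.restrict K)).prod
          ((volume.restrict K).prod (volume.restrict K)))).toReal := by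
  classical
  rw [EHdiag, unif_eq_restrict hvol]
  set μ : Measure (Euc 2) := volume.restrict K
  have : IsProbabilityMeasure μ := ⟨by simp [μ, hvol]⟩
  have hsphere : ∀ p r, μ (Metric.sphere p r) = 0 := fun p r =>
    Measure.restrict_le_self.absolutelyContinuous (Measure.addHaar_sphere volume p r)
  have hae : (fun x : Fin n → Euc 2 => (holeCountDiag n x : ℝ)) =ᵐ[Measure.pi fun _ => μ]
      fun x => 2⁻¹ * ∑ e : Fin 2 ⊕ Fin 2 ↪ Fin n,
        (emptyQuadEvent e).indicator (fun _ => (1 : ℝ)) x := by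
    filter_upwards [ae_distinctDist hsphere n] with x hx
    have h := two_mul_holeCountDiag hx
    rw [Finset.card_filter] at h
    have h' : (2 : ℝ) * holeCountDiag n x =
        ∑ e : Fin 2 ⊕ Fin 2 ↪ Fin n,
        (emptyQuadEvent e).indicator (fun _ => (1 : ℝ)) x := by
      rw [← Nat.cast_ofNat, ← Nat.cast_mul, h]
      push_cast
      exact Finset.sum_congr rfl fun e _ => by simp [Set.indicator_apply]
    rw [← h']; ring
  rw [integral_congr_ae hae, integral_const_mul, integral_finsetSum]
  · simp_rw [integral_indicator_const _ (measure_emptyQuadEvent μ _).1, Measure.real,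
      (measure_emptyQuadEvent μ _).2]
    rw [Finset.sum_const, Finset.card_univ, Fintype.card_embedding_eq, nsmul_eq_mul]
    simp only [Fintype.card_sum, Fintype.card_fin]
    ring
  · intro e _
    exact (integrable_const 1).indicator (measure_emptyQuadEvent μ e).1

/-- The exponential density with rate `r` on the half-strip `(0, 1) × (0, ∞)`. -/
noncomputable def stripExp (r : ℝ) : ℝ × ℝ → ℝ≥0∞ :=
  (Set.Ioo (0 : ℝ) 1 ×ˢ Set.Ioi (0 : ℝ)).indicator fun q => ENNReal.ofReal (Real.exp (-(r * q.2)))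

lemma measurable_stripExp (r : ℝ) : Measurable (stripExp r) :=
  Measurable.indicator (by fun_prop) (measurableSet_Ioo.prod measurableSet_Ioi)

lemma lintegral_stripExp {r : ℝ} (hr : 0 < r) : ∫⁻ q, stripExp r q = ENNReal.ofReal r⁻¹ := by
  rw [stripExp, lintegral_indicator (measurableSet_Ioo.prod measurableSet_Ioi),
    Measure.volume_eq_prod, ← Measure.prod_restrict,
    lintegral_prod _ (by fun_prop)]
  simp only [lintegral_const, Measure.restrict_apply_univ, Real.volume_Ioo, sub_zero,
    ENNReal.ofReal_one, mul_one]
  rw [← ofReal_integral_eq_lintegral_ofReal]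
  · congr 1
    simp_rw [← neg_mul]
    rw [integral_exp_mul_Ioi (neg_neg_of_pos hr)]
    simp [neg_div_neg_eq]
  · simp_rw [← neg_mul]
    exact (integrableOn_exp_mul_Ioi (neg_neg_of_pos hr) 0)
  · exact Eventually.of_forall fun _ => (Real.exp_pos _).le

lemma lintegral_stripExp_prod {r : ℝ} (hr : 0 < r) :
    ∫⁻ q : (ℝ × ℝ) × (ℝ × ℝ), stripExp r q.1 * stripExp r q.2 = ENNReal.ofReal (r⁻¹ ^ 2) := by
  rw [Measure.volume_eq_prod, lintegral_prod_mul (measurable_stripExp r).aemeasurable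
    (measurable_stripExp r).aemeasurable, lintegral_stripExp hr,
    ← ENNReal.ofReal_mul (by positivity), sq]

/-- The density of the avoidance probability in rescaled frame coordinates. -/
noncomputable def rescaledProb (K : Set (Euc 2)) (a b : Euc 2) (n : ℕ)
    (q : (ℝ × ℝ) × (ℝ × ℝ)) : ℝ≥0∞ :=
  K.indicator (fun c => K.indicator
    (fun d => avoidProb (volume.restrict K) (n - 4) ((a, b), (c, d)))
    (frame a b q.2.1 (-(n : ℝ)⁻¹ * q.2.2))) (frame a b q.1.1 ((n : ℝ)⁻¹ * q.1.2))

lemma continuous_frame (a b : Euc 2) : Continuous fun q : ℝ × ℝ => frame a b q.1 q.2 := by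
  unfold frame; fun_prop

section

variable {K : Set (Euc 2)}

lemma measurable_indicator_avoidProb (hK : MeasurableSet K) (hvol : volume K = 1) (a b : Euc 2)
    (m : ℕ) : Measurable fun w : Euc 2 × Euc 2 =>
      K.indicator (fun c => K.indicator
        (fun d => avoidProb (volume.restrict K) m ((a, b), (c, d))) w.2) w.1 := by
  have : IsProbabilityMeasure (volume.restrict K) := ⟨by simp [hvol]⟩
  have hm : Measurable fun w : Euc 2 × Euc 2 => avoidProb (volume.restrict K) m ((a, b), w) :=
    (measurable_avoidProb _ m).comp measurable_prodMk_left
  convert hm.indicator (hK.prod hK) using 2 with w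
  by_cases h1 : w.1 ∈ K <;> by_cases h2 : w.2 ∈ K <;> simp [h1, h2]

lemma measurable_rescaledProb (hK : MeasurableSet K) (hvol : volume K = 1) (a b : Euc 2) (n : ℕ) :
    Measurable (rescaledProb K a b n) := by
  have h1 : Measurable fun q : (ℝ × ℝ) × (ℝ × ℝ) =>
      (frame a b q.1.1 ((n : ℝ)⁻¹ * q.1.2), frame a b q.2.1 (-(n : ℝ)⁻¹ * q.2.2)) := by
    apply Continuous.measurable
    unfold frame; fun_prop
  exact (measurable_indicator_avoidProb hK hvol a b (n - 4)).comp h1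

/-- Change of variables to the rescaled frame coordinates. -/
lemma sq_mul_lintegral_avoidProb (hK : MeasurableSet K) (hvol : volume K = 1) {a b : Euc 2}
    (hab : a ≠ b) {n : ℕ} (hn : n ≠ 0) :
    (n : ℝ≥0∞) ^ 2 * ∫⁻ w, avoidProb (volume.restrict K) (n - 4) ((a, b), w)
        ∂((volume.restrict K).prod (volume.restrict K)) =
      ENNReal.ofReal ((dist a b ^ 2) ^ 2) * ∫⁻ q, rescaledProb K a b n q := by
  have : IsProbabilityMeasure (volume.restrict K) := ⟨by simp [hvol]⟩
  have hn' : (n : ℝ) ≠ 0 := by exact_mod_cast hn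
  have hpos : (0 : ℝ) < n := by positivity
  have hm : Measurable fun w : Euc 2 × Euc 2 =>
      avoidProb (volume.restrict K) (n - 4) ((a, b), w) :=
    (measurable_avoidProb _ _).comp measurable_prodMk_left
  have hI := measurable_indicator_avoidProb hK hvol a b (n - 4)
  have hstep : ∀ c, ∫⁻ d, K.indicator (fun c => K.indicator
        (fun d => avoidProb (volume.restrict K) (n - 4) ((a, b), (c, d))) d) c =
      K.indicator (fun c => ∫⁻ d, K.indicator
        (fun d => avoidProb (volume.restrict K) (n - 4) ((a, b), (c, d))) d) c := by
    intro c
    by_cases hc : c ∈ K <;> simp [hc]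
  have hJ : Measurable fun c => ∫⁻ d, K.indicator (fun c => K.indicator
        (fun d => avoidProb (volume.restrict K) (n - 4) ((a, b), (c, d))) d) c :=
    hI.lintegral_prod_right'
  have h2 : ∫⁻ w, avoidProb (volume.restrict K) (n - 4) ((a, b), w)
        ∂((volume.restrict K).prod (volume.restrict K)) =
      ∫⁻ c, ∫⁻ d, K.indicator (fun c => K.indicator
        (fun d => avoidProb (volume.restrict K) (n - 4) ((a, b), (c, d))) d) c := by
    rw [lintegral_prod _ hm.aemeasurable]
    simp_rw [hstep]
    rw [lintegral_indicator hK]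
    simp_rw [lintegral_indicator hK]
  have hq : Measurable (rescaledProb K a b n) := measurable_rescaledProb hK hvol a b n
  rw [h2, lintegral_frame hab (inv_ne_zero hn') hJ, Measure.volume_eq_prod (ℝ × ℝ) (ℝ × ℝ),
    lintegral_prod _ hq.aemeasurable]
  have h3 : ∀ c, ∫⁻ d, K.indicator (fun c => K.indicator
        (fun d => avoidProb (volume.restrict K) (n - 4) ((a, b), (c, d))) d) c =
      ENNReal.ofReal (dist a b ^ 2 * |-(n : ℝ)⁻¹|) * ∫⁻ q : ℝ × ℝ, K.indicator (fun c =>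
        K.indicator (fun d => avoidProb (volume.restrict K) (n - 4) ((a, b), (c, d)))
          (frame a b q.1 (-(n : ℝ)⁻¹ * q.2))) c := fun c =>
    lintegral_frame hab (neg_ne_zero.2 (inv_ne_zero hn')) (hI.comp measurable_prodMk_left)
  simp_rw [h3]
  rw [lintegral_const_mul' _ _ ENNReal.ofReal_ne_top, ← mul_assoc, ← mul_assoc]
  congr 1
  rw [abs_neg, abs_inv, abs_of_pos hpos, ← ENNReal.ofReal_natCast, ← ENNReal.ofReal_pow hpos.le,
    ← ENNReal.ofReal_mul (by positivity), ← ENNReal.ofReal_mul (by positivity)]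
  congr 1
  field_simp

lemma IsLongDiagonal.volume_restrict_openQuad (hconv : Convex ℝ K) {a b c d : Euc 2}
    (h : IsLongDiagonal a b c d) (ha : a ∈ K) (hb : b ∈ K) (hc : c ∈ K) (hd : d ∈ K) :
    volume.restrict K (openQuad a b c d) = volume (openQuad a b c d) := by
  rw [Measure.restrict_apply (isOpen_openQuad _ _ _ _).measurableSet, Set.inter_eq_left.2]
  rw [← h.interior_convexHull]
  refine interior_subset.trans (convexHull_min ?_ hconv)
  rintro p (rfl | rfl | rfl | rfl) <;> assumption

/-- The explicit form of the rescaled density. -/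
lemma rescaledProb_of_mem (hconv : Convex ℝ K) {a b : Euc 2} (ha : a ∈ K) (hb : b ∈ K)
    (hab : a ≠ b) {n : ℕ} {q : (ℝ × ℝ) × (ℝ × ℝ)}
    (hc : frame a b q.1.1 ((n : ℝ)⁻¹ * q.1.2) ∈ K)
    (hd : frame a b q.2.1 (-(n : ℝ)⁻¹ * q.2.2) ∈ K)
    (h : IsLongDiagonal a b (frame a b q.1.1 ((n : ℝ)⁻¹ * q.1.2))
      (frame a b q.2.1 (-(n : ℝ)⁻¹ * q.2.2))) :
    rescaledProb K a b n q =
      ENNReal.ofReal (1 - dist a b ^ 2 * (q.1.2 + q.2.2) / 2 / n) ^ (n - 4) := by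
  obtain ⟨h1, h2, h3, h4, h5, h6, -⟩ := (isLongDiagonal_frame_iff hab _ _ _ _).1 h
  have hmem : (((a, b), (frame a b q.1.1 ((n : ℝ)⁻¹ * q.1.2),
      frame a b q.2.1 (-(n : ℝ)⁻¹ * q.2.2))) : (Euc 2 × Euc 2) × (Euc 2 × Euc 2)) ∈
      longDiagonals := h
  rw [rescaledProb, Set.indicator_of_mem hc, Set.indicator_of_mem hd, avoidProb,
    Set.indicator_of_mem hmem, h.volume_restrict_openQuad hconv ha hb hc hd,
    volume_openQuad_frame hab h1 h2 (mem_Ioo_of_lens h1.ne' h3 h4) (mem_Ioo_of_lens h2.ne h5 h6),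
    ← ENNReal.ofReal_one, ← ENNReal.ofReal_sub]
  · congr 2; ring
  · have := mul_nonneg (dist_sq_pos hab).le (sub_nonneg.2 (h2.trans h1).le)
    linarith

lemma mem_strip_of_isLongDiagonal {a b : Euc 2} (hab : a ≠ b) {n : ℕ} {q : (ℝ × ℝ) × (ℝ × ℝ)}
    (h : IsLongDiagonal a b (frame a b q.1.1 ((n : ℝ)⁻¹ * q.1.2))
      (frame a b q.2.1 (-(n : ℝ)⁻¹ * q.2.2))) :
    q.1 ∈ Set.Ioo (0 : ℝ) 1 ×ˢ Set.Ioi (0 : ℝ) ∧ q.2 ∈ Set.Ioo (0 : ℝ) 1 ×ˢ Set.Ioi (0 : ℝ) := by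
  obtain ⟨h1, h2, h3, h4, h5, h6, -⟩ := (isLongDiagonal_frame_iff hab _ _ _ _).1 h
  have hn : (0 : ℝ) ≤ (n : ℝ)⁻¹ := by positivity
  refine ⟨⟨mem_Ioo_of_lens h1.ne' h3 h4, pos_of_mul_pos_right h1 hn⟩,
    ⟨mem_Ioo_of_lens h2.ne h5 h6, ?_⟩⟩
  rw [neg_mul, neg_lt_zero] at h2
  exact pos_of_mul_pos_right h2 hn

lemma rescaledProb_eq_zero {a b : Euc 2} {n : ℕ} {q : (ℝ × ℝ) × (ℝ × ℝ)}
    (h : ¬ (frame a b q.1.1 ((n : ℝ)⁻¹ * q.1.2) ∈ K ∧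
      frame a b q.2.1 (-(n : ℝ)⁻¹ * q.2.2) ∈ K ∧
      IsLongDiagonal a b (frame a b q.1.1 ((n : ℝ)⁻¹ * q.1.2))
        (frame a b q.2.1 (-(n : ℝ)⁻¹ * q.2.2)))) :
    rescaledProb K a b n q = 0 := by
  rw [rescaledProb]
  by_cases hc : frame a b q.1.1 ((n : ℝ)⁻¹ * q.1.2) ∈ K
  · by_cases hd : frame a b q.2.1 (-(n : ℝ)⁻¹ * q.2.2) ∈ K
    · rw [Set.indicator_of_mem hc, Set.indicator_of_mem hd, avoidProb, Set.indicator_of_notMem]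
      exact fun hl => h ⟨hc, hd, hl⟩
    · rw [Set.indicator_of_mem hc, Set.indicator_of_notMem hd]
  · rw [Set.indicator_of_notMem hc]

/-- The rescaled density is dominated by an integrable function. -/
lemma rescaledProb_le (hconv : Convex ℝ K) {a b : Euc 2} (ha : a ∈ K) (hb : b ∈ K)
    (hab : a ≠ b) {n : ℕ} (hn : 8 ≤ n) (q : (ℝ × ℝ) × (ℝ × ℝ)) :
    rescaledProb K a b n q ≤
      stripExp (dist a b ^ 2 / 4) q.1 * stripExp (dist a b ^ 2 / 4) q.2 := by
  by_cases h : frame a b q.1.1 ((n : ℝ)⁻¹ * q.1.2) ∈ K ∧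
      frame a b q.2.1 (-(n : ℝ)⁻¹ * q.2.2) ∈ K ∧
      IsLongDiagonal a b (frame a b q.1.1 ((n : ℝ)⁻¹ * q.1.2))
        (frame a b q.2.1 (-(n : ℝ)⁻¹ * q.2.2))
  · obtain ⟨hc, hd, hl⟩ := h
    obtain ⟨hq1, hq2⟩ := mem_strip_of_isLongDiagonal hab hl
    have hs : (0 : ℝ) < q.1.2 := hq1.2
    have hs' : (0 : ℝ) < q.2.2 := hq2.2
    have hn' : (8 : ℝ) ≤ n := by exact_mod_cast hn
    have hL := dist_sq_pos hab
    rw [rescaledProb_of_mem hconv ha hb hab hc hd hl, stripExp,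
      Set.indicator_of_mem hq1, Set.indicator_of_mem hq2,
      ← ENNReal.ofReal_mul (Real.exp_pos _).le, ← Real.exp_add]
    set A := dist a b ^ 2 * (q.1.2 + q.2.2) / 2 / n with hA
    have h1 : ENNReal.ofReal (1 - A) ≤ ENNReal.ofReal (Real.exp (-A)) :=
      ENNReal.ofReal_le_ofReal (Real.one_sub_le_exp_neg A)
    refine (pow_le_pow_left' h1 _).trans ?_
    rw [← ENNReal.ofReal_pow (Real.exp_pos _).le, ← Real.exp_nat_mul]
    refine ENNReal.ofReal_le_ofReal (Real.exp_le_exp.2 ?_)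
    rw [Nat.cast_sub (by omega), hA]
    have hP : 0 < dist a b ^ 2 * (q.1.2 + q.2.2) := by positivity
    have : ((n : ℝ) - 4) / n ≥ 1 / 2 := by
      rw [ge_iff_le, div_le_div_iff₀ (by norm_num) (by linarith)]; linarith
    have h2 := mul_le_mul_of_nonneg_left this hP.le
    have h3 : ((n : ℝ) - (4 : ℕ)) * -(dist a b ^ 2 * (q.1.2 + q.2.2) / 2 / n) =
        - (dist a b ^ 2 * (q.1.2 + q.2.2) * (((n : ℝ) - 4) / n)) / 2 := by
      push_cast; ring
    rw [h3]
    linarith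
  · rw [rescaledProb_eq_zero h]; exact zero_le

lemma tendsto_one_sub_div_pow (t : ℝ) :
    Tendsto (fun n : ℕ => ENNReal.ofReal (1 - t / n) ^ (n - 4)) atTop
      (nhds (ENNReal.ofReal (Real.exp (-t)))) := by
  have h0 : Tendsto (fun n : ℕ => 1 - t / (n : ℝ)) atTop (nhds 1) := by
    simpa using (tendsto_const_div_atTop_nhds_zero_nat t).const_sub 1
  have h1 : Tendsto (fun n : ℕ => (1 + -t / (n : ℝ)) ^ n / (1 - t / (n : ℝ)) ^ 4) atTop
      (nhds (Real.exp (-t) / 1 ^ 4)) :=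
    (Real.tendsto_one_add_div_pow_exp (-t)).div (h0.pow 4) (by norm_num)
  rw [one_pow, div_one] at h1
  refine (ENNReal.tendsto_ofReal h1).congr' ?_
  filter_upwards [h0.eventually_const_lt one_pos, eventually_ge_atTop 4] with n hn hn4
  rw [← ENNReal.ofReal_pow hn.le, pow_sub₀ _ hn.ne' hn4]
  congr 1
  rw [neg_div, ← sub_eq_add_neg]
  rfl

/-- Points of the half-strip eventually yield long-diagonal quadruples inside the body. -/
lemma eventually_isLongDiagonal (hconv : Convex ℝ K) {a b : Euc 2} (ha : a ∈ interior K)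
    (hb : b ∈ interior K) (hab : a ≠ b) {q : (ℝ × ℝ) × (ℝ × ℝ)}
    (hq1 : q.1 ∈ Set.Ioo (0 : ℝ) 1 ×ˢ Set.Ioi (0 : ℝ))
    (hq2 : q.2 ∈ Set.Ioo (0 : ℝ) 1 ×ˢ Set.Ioi (0 : ℝ)) :
    ∀ᶠ n : ℕ in atTop, frame a b q.1.1 ((n : ℝ)⁻¹ * q.1.2) ∈ K ∧
      frame a b q.2.1 (-(n : ℝ)⁻¹ * q.2.2) ∈ K ∧
      IsLongDiagonal a b (frame a b q.1.1 ((n : ℝ)⁻¹ * q.1.2))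
        (frame a b q.2.1 (-(n : ℝ)⁻¹ * q.2.2)) := by
  obtain ⟨⟨hx0, hx1⟩, hs⟩ := hq1
  obtain ⟨⟨hx0', hx1'⟩, hs'⟩ := hq2
  have hs : (0 : ℝ) < q.1.2 := hs
  have hs' : (0 : ℝ) < q.2.2 := hs'
  have hinv : Tendsto (fun n : ℕ => (n : ℝ)⁻¹) atTop (nhds 0) := tendsto_inv_atTop_nhds_zero_nat
  have hmem : ∀ x ∈ Set.Ioo (0 : ℝ) 1, ∀ y : ℕ → ℝ, Tendsto y atTop (nhds 0) →
      ∀ᶠ n in atTop, frame a b x (y n) ∈ K := by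
    intro x hx y hy
    have h0 : frame a b x 0 ∈ interior K := by
      refine hconv.interior.segment_subset ha hb
        ⟨1 - x, x, by linarith [hx.2], hx.1.le, by ring, ?_⟩
      ext i; fin_cases i <;> simp <;> ring
    have ht : Tendsto (fun n => frame a b x (y n)) atTop (nhds (frame a b x 0)) :=
      ((continuous_frame a b).tendsto (x, 0)).comp (tendsto_const_nhds.prodMk_nhds hy)
    exact ht.eventually (mem_interior_iff_mem_nhds.1 h0)
  have hy : Tendsto (fun n : ℕ => (n : ℝ)⁻¹ * q.1.2) atTop (nhds 0) := by
    simpa using hinv.mul_const q.1.2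
  have hy' : Tendsto (fun n : ℕ => -(n : ℝ)⁻¹ * q.2.2) atTop (nhds 0) := by
    simpa using hinv.neg.mul_const q.2.2
  have hlens : ∀ x : ℝ, x ^ 2 < 1 → ∀ y : ℕ → ℝ, Tendsto y atTop (nhds 0) →
      ∀ᶠ n in atTop, x ^ 2 + y n ^ 2 ≤ 1 := by
    intro x hx y hy
    have : Tendsto (fun n => x ^ 2 + y n ^ 2) atTop (nhds (x ^ 2)) := by
      simpa using (hy.pow 2).const_add (x ^ 2)
    exact (this.eventually_lt_const hx).mono fun n hn => hn.le
  have hyy : Tendsto (fun n : ℕ => (n : ℝ)⁻¹ * q.1.2 - -(n : ℝ)⁻¹ * q.2.2) atTop (nhds 0) := by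
    simpa using hy.sub hy'
  filter_upwards [hmem _ ⟨hx0, hx1⟩ _ hy, hmem _ ⟨hx0', hx1'⟩ _ hy',
    hlens _ (show q.1.1 ^ 2 < 1 by nlinarith) _ hy,
    hlens _ (show (1 - q.1.1) ^ 2 < 1 by nlinarith) _ hy,
    hlens _ (show q.2.1 ^ 2 < 1 by nlinarith) _ hy',
    hlens _ (show (1 - q.2.1) ^ 2 < 1 by nlinarith) _ hy',
    hlens _ (show (q.1.1 - q.2.1) ^ 2 < 1 by nlinarith) _ hyy,
    eventually_gt_atTop 0] with n h1 h2 h3 h4 h5 h6 h7 h8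
  have hn : (0 : ℝ) < (n : ℝ)⁻¹ := by positivity
  refine ⟨h1, h2, (isLongDiagonal_frame_iff hab _ _ _ _).2
    ⟨mul_pos hn hs, ?_, h3, h4, h5, h6, h7⟩⟩
  rw [neg_mul, neg_lt_zero]
  exact mul_pos hn hs'

lemma tendsto_rescaledProb (hconv : Convex ℝ K) {a b : Euc 2} (ha : a ∈ interior K)
    (hb : b ∈ interior K) (hab : a ≠ b) (q : (ℝ × ℝ) × (ℝ × ℝ)) :
    Tendsto (fun n => rescaledProb K a b n q) atTop
      (nhds (stripExp (dist a b ^ 2 / 2) q.1 * stripExp (dist a b ^ 2 / 2) q.2)) := by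
  by_cases hq : q.1 ∈ Set.Ioo (0 : ℝ) 1 ×ˢ Set.Ioi (0 : ℝ) ∧
      q.2 ∈ Set.Ioo (0 : ℝ) 1 ×ˢ Set.Ioi (0 : ℝ)
  · obtain ⟨hq1, hq2⟩ := hq
    rw [stripExp, Set.indicator_of_mem hq1, Set.indicator_of_mem hq2,
      ← ENNReal.ofReal_mul (Real.exp_pos _).le, ← Real.exp_add]
    have h := tendsto_one_sub_div_pow (dist a b ^ 2 * (q.1.2 + q.2.2) / 2)
    have he : -(dist a b ^ 2 * (q.1.2 + q.2.2) / 2) =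
        -(dist a b ^ 2 / 2 * q.1.2) + -(dist a b ^ 2 / 2 * q.2.2) := by ring
    rw [he] at h
    refine h.congr' ?_
    filter_upwards [eventually_isLongDiagonal hconv ha hb hab hq1 hq2] with n hn
    exact (rescaledProb_of_mem hconv (interior_subset ha) (interior_subset hb) hab hn.1 hn.2.1
      hn.2.2).symm
  · have hz : stripExp (dist a b ^ 2 / 2) q.1 * stripExp (dist a b ^ 2 / 2) q.2 = 0 := by
      rcases not_and_or.1 hq with h | h
      · rw [stripExp, Set.indicator_of_notMem h, zero_mul]
      · rw [mul_comm, stripExp, Set.indicator_of_notMem h, zero_mul]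
    rw [hz]
    refine tendsto_const_nhds.congr fun n => (rescaledProb_eq_zero ?_).symm
    rintro ⟨-, -, hl⟩
    exact hq (mem_strip_of_isLongDiagonal hab hl)

/-- The scaled probability, given the two endpoints `a` and `b` of the long diagonal. -/
noncomputable def scaledProb (K : Set (Euc 2)) (n : ℕ) (w : Euc 2 × Euc 2) : ℝ≥0∞ :=
  (n : ℝ≥0∞) ^ 2 * ∫⁻ v, avoidProb (volume.restrict K) (n - 4) (w, v)
    ∂((volume.restrict K).prod (volume.restrict K))

lemma scaledProb_le (hK : MeasurableSet K) (hconv : Convex ℝ K) (hvol : volume K = 1)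
    {a b : Euc 2} (ha : a ∈ K) (hb : b ∈ K) {n : ℕ} (hn : 8 ≤ n) :
    scaledProb K n (a, b) ≤ 16 := by
  rcases eq_or_ne a b with rfl | hab
  · have : ∀ v, avoidProb (volume.restrict K) (n - 4) ((a, a), v) = 0 := by
      intro v
      rw [avoidProb, Set.indicator_of_notMem]
      exact fun h : IsLongDiagonal a a v.1 v.2 => h.ne rfl
    simp [scaledProb, this]
  · have hL := dist_sq_pos hab
    rw [scaledProb, sq_mul_lintegral_avoidProb hK hvol hab (by omega)]
    calc _ ≤ ENNReal.ofReal ((dist a b ^ 2) ^ 2) * ∫⁻ q : (ℝ × ℝ) × (ℝ × ℝ),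
          stripExp (dist a b ^ 2 / 4) q.1 * stripExp (dist a b ^ 2 / 4) q.2 := by
          gcongr with q
          exact rescaledProb_le hconv ha hb hab hn q
      _ = 16 := by
          rw [lintegral_stripExp_prod (by positivity), ← ENNReal.ofReal_mul (by positivity)]
          have : (dist a b ^ 2) ^ 2 * (dist a b ^ 2 / 4)⁻¹ ^ 2 = 16 := by
            generalize dist a b ^ 2 = L at hL
            field_simp
            norm_num
          rw [this]; simp

lemma tendsto_scaledProb (hK : MeasurableSet K) (hconv : Convex ℝ K) (hvol : volume K = 1)
    {a b : Euc 2} (ha : a ∈ interior K) (hb : b ∈ interior K) (hab : a ≠ b) :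
    Tendsto (fun n => scaledProb K n (a, b)) atTop (nhds 4) := by
  have hL := dist_sq_pos hab
  have h : Tendsto (fun n => ∫⁻ q, rescaledProb K a b (n + 8) q) atTop
      (nhds (∫⁻ q : (ℝ × ℝ) × (ℝ × ℝ),
        stripExp (dist a b ^ 2 / 2) q.1 * stripExp (dist a b ^ 2 / 2) q.2)) := by
    refine tendsto_lintegral_of_dominated_convergence
      (fun q => stripExp (dist a b ^ 2 / 4) q.1 * stripExp (dist a b ^ 2 / 4) q.2)
      (fun n => measurable_rescaledProb hK hvol a b _)
      (fun n => Eventually.of_forall fun q => rescaledProb_le hconv (interior_subset ha)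
        (interior_subset hb) hab (by omega) q) ?_
      (Eventually.of_forall fun q => (tendsto_add_atTop_iff_nat 8).2
        (tendsto_rescaledProb hconv ha hb hab q))
    rw [lintegral_stripExp_prod (by positivity)]
    exact ENNReal.ofReal_ne_top
  rw [← tendsto_add_atTop_iff_nat 8]
  have h' := ENNReal.Tendsto.const_mul (a := ENNReal.ofReal ((dist a b ^ 2) ^ 2)) h
    (Or.inr ENNReal.ofReal_ne_top)
  rw [lintegral_stripExp_prod (by positivity), ← ENNReal.ofReal_mul (by positivity)] at h'
  have h4 : ENNReal.ofReal ((dist a b ^ 2) ^ 2 * (dist a b ^ 2 / 2)⁻¹ ^ 2) = 4 := by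
    have : (dist a b ^ 2) ^ 2 * (dist a b ^ 2 / 2)⁻¹ ^ 2 = 4 := by
            generalize dist a b ^ 2 = L at hL
            field_simp
            norm_num
    rw [this]; simp
  rw [h4] at h'
  exact h'.congr fun n => (sq_mul_lintegral_avoidProb hK hvol hab (by omega)).symm

lemma tendsto_sq_mul_lintegral (hK : IsConvexBody K) (hvol : volume K = 1) :
    Tendsto (fun n : ℕ => (n : ℝ≥0∞) ^ 2 * ∫⁻ w, avoidProb (volume.restrict K) (n - 4) w
        ∂(((volume.restrict K).prod (volume.restrict K)).prod
          ((volume.restrict K).prod (volume.restrict K)))) atTop (nhds 4) := by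
  obtain ⟨hconv, hcomp, -⟩ := hK
  have hKm : MeasurableSet K := hcomp.isClosed.measurableSet
  have : IsProbabilityMeasure (volume.restrict K) := ⟨by simp [hvol]⟩
  have hmeas : ∀ n, Measurable (scaledProb K n) := fun n =>
    (measurable_avoidProb _ _).lintegral_prod_right'.const_mul _
  have hintg : ∀ᵐ p ∂(volume.restrict K), p ∈ interior K := by
    have h1 : ∀ᵐ p ∂(volume.restrict K), p ∉ frontier K :=
      measure_eq_zero_iff_ae_notMem.1
        (Measure.restrict_le_self.absolutelyContinuous (hconv.addHaar_frontier volume))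
    filter_upwards [h1, ae_restrict_mem hKm] with p hp hpK
    by_contra hi
    exact hp ⟨subset_closure hpK, hi⟩
  have hintg2 : ∀ᵐ w ∂((volume.restrict K).prod (volume.restrict K)),
      w.1 ∈ interior K ∧ w.2 ∈ interior K :=
    (Measure.quasiMeasurePreserving_fst.ae hintg).and (Measure.quasiMeasurePreserving_snd.ae hintg)
  have hne : ∀ᵐ w ∂((volume.restrict K).prod (volume.restrict K)), w.1 ≠ w.2 := by
    have hm : MeasurableSet {w : Euc 2 × Euc 2 | w.1 = w.2} := measurableSet_diagonal
    rw [ae_iff]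
    simp only [ne_eq, not_not]
    rw [Measure.prod_apply hm, lintegral_eq_zero_iff (measurable_measure_prodMk_left hm)]
    refine Eventually.of_forall fun p => ?_
    have : Prod.mk p ⁻¹' {w : Euc 2 × Euc 2 | w.1 = w.2} = {p} := by
      ext z; simp [eq_comm]
    simp [this]
  have h : Tendsto (fun n => ∫⁻ w, scaledProb K (n + 8) w
      ∂((volume.restrict K).prod (volume.restrict K))) atTop
      (nhds (∫⁻ _, 4 ∂((volume.restrict K).prod (volume.restrict K)))) := by
    refine tendsto_lintegral_of_dominated_convergence (fun _ => 16) (fun n => hmeas _) ?_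
      (by simp) ?_
    · intro n
      filter_upwards [hintg2] with w hw
      exact scaledProb_le hKm hconv hvol (interior_subset hw.1) (interior_subset hw.2) (by omega)
    · filter_upwards [hintg2, hne] with w hw hw'
      exact (tendsto_add_atTop_iff_nat 8).2 (tendsto_scaledProb hKm hconv hvol hw.1 hw.2 hw')
  rw [tendsto_add_atTop_iff_nat (f := fun n => ∫⁻ w, scaledProb K n w
      ∂((volume.restrict K).prod (volume.restrict K))) 8] at h
  simp only [lintegral_const, measure_univ, mul_one] at h
  refine h.congr fun n => ?_
  unfold scaledProb
  rw [lintegral_const_mul _ (measurable_avoidProb _ _).lintegral_prod_right',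
    lintegral_prod _ (measurable_avoidProb _ _).aemeasurable]

end

lemma tendsto_descFactorial_div (k : ℕ) :
    Tendsto (fun n : ℕ => (n.descFactorial k : ℝ) / (n : ℝ) ^ k) atTop (nhds 1) := by
  induction k with
  | zero => simp
  | succ k ih =>
    have h : Tendsto (fun n : ℕ => 1 - (k : ℝ) / n) atTop (nhds 1) := by
      simpa using (tendsto_const_div_atTop_nhds_zero_nat (k : ℝ)).const_sub 1
    have h2 := h.mul ih
    rw [mul_one] at h2
    refine h2.congr' ?_
    filter_upwards [eventually_ge_atTop (k + 1)] with n hn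
    have : (0 : ℝ) < n := by exact_mod_cast (by omega : 0 < n)
    rw [Nat.descFactorial_succ, Nat.cast_mul, Nat.cast_sub (by omega), pow_succ]
    field_simp

/-- For every convex body `K ⊆ ℝ²` of unit area, the expected number `N₁(n)` of
4-holes whose maximum-distance pair forms a diagonal satisfies
`n^{-2} E[N₁(n)] → 2` as `n → ∞`. -/
theorem statement14 (K : Set (Euc 2)) (hK : IsConvexBody K) (hvol : volume K = 1) :
    Filter.Tendsto (fun n : ℕ => EHdiag K n / (n : ℝ) ^ 2) Filter.atTop
      (nhds 2) := by
  have h1 := (ENNReal.tendsto_toReal (by simp : (4 : ℝ≥0∞) ≠ ∞)).comp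
    (tendsto_sq_mul_lintegral hK hvol)
  have h2 := ((tendsto_descFactorial_div 4).div_const 2).mul h1
  rw [show (1 : ℝ) / 2 * (4 : ℝ≥0∞).toReal = 2 by norm_num] at h2
  refine h2.congr' ?_
  filter_upwards [eventually_gt_atTop 0] with n hn
  have : (0 : ℝ) < n := by exact_mod_cast hn
  simp only [Function.comp_apply, ENNReal.toReal_mul, ENNReal.toReal_pow, ENNReal.toReal_natCast]
  rw [EHdiag_eq hvol]
  field_simp
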